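/- arXiv:1810.12991 — 2 statements merged into one kernel-verified Lean document; each statement's English description precedes it below -/
import Mathlib

section
/- Weighted Trudinger–Moser inequality: for every ε with 0 < ε < 4π there exists a constant C(ε) > 0 such that for every a ∈ ℝ and every u ∈ 𝓗̃ one has ∫_{ℝ²} e^{a|u|} dμ ≤ C(ε) · exp( (a²/(4(4π−ε))) · ‖∇u‖²_{L²(ℝ²,dx)} ). -/
noncomputable section

open MeasureTheory Real Filter Topology
open scoped ENNReal

abbrev Plane : Type := EuclideanSpace ℝ (Fin 2)

/-- The weighted measure dμ = h₀ dx on the plane. -/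
def wMeasure (h₀ : Plane → ℝ) : Measure Plane :=
  volume.withDensity fun x => ENNReal.ofReal (h₀ x)

/-- Membership in the weighted Sobolev space 𝓗 : the (distributional) gradient is
square integrable with respect to Lebesgue measure and the function itself is square
integrable with respect to the weighted measure dμ. -/
def MemH (h₀ : Plane → ℝ) (u : Plane → ℝ) : Prop :=
  Differentiable ℝ u ∧
    Integrable (fun x => ‖gradient u x‖ ^ 2) volume ∧
    Integrable (fun x => u x ^ 2) (wMeasure h₀)

/-- Membership in 𝓗̃, the subspace of 𝓗 of functions with zero dμ-mean. -/
def MemHt (h₀ : Plane → ℝ) (u : Plane → ℝ) : Prop :=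
  MemH h₀ u ∧ ∫ x, u x ∂(wMeasure h₀) = 0

/-- The squared 𝓗-norm: ‖u‖²_𝓗 = ‖∇u‖²_{L²(dx)} + ‖u‖²_{L²(dμ)}. -/
def HnormSq (h₀ : Plane → ℝ) (u : Plane → ℝ) : ℝ :=
  (∫ x, ‖gradient u x‖ ^ 2) + ∫ x, u x ^ 2 ∂(wMeasure h₀)

/-- The 𝓗-norm. -/
def Hnorm (h₀ : Plane → ℝ) (u : Plane → ℝ) : ℝ :=
  Real.sqrt (HnormSq h₀ u)

/-- The unit vector of the plane with polar angle `θ`. -/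
def unitVec (θ : ℝ) : Plane := !₂[Real.cos θ, Real.sin θ]

lemma norm_unitVec (θ : ℝ) : ‖unitVec θ‖ = 1 := by
  simp [unitVec, EuclideanSpace.norm_eq, Fin.sum_univ_two]

lemma continuous_unitVec : Continuous unitVec := by
  unfold unitVec
  fun_prop

lemma norm_add_smul_unitVec_sub (x : Plane) {ρ : ℝ} (hρ : 0 ≤ ρ) (θ : ℝ) :
    ‖x + ρ • unitVec θ - x‖ = ρ := by
  rw [add_sub_cancel_left, norm_smul, norm_unitVec, mul_one, Real.norm_of_nonneg hρ]

lemma injOn_unitVec : Set.InjOn unitVec (Set.Ioo (-π) π) := by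
  intro θ hθ φ hφ h
  have h0 : Real.cos θ = Real.cos φ := by
    simpa [unitVec] using congrArg (fun z : Plane => z 0) h
  have h1 : Real.sin θ = Real.sin φ := by
    simpa [unitVec] using congrArg (fun z : Plane => z 1) h
  rw [← Complex.arg_cos_add_sin_mul_I (Set.Ioo_subset_Ioc_self hθ),
    ← Complex.arg_cos_add_sin_mul_I (Set.Ioo_subset_Ioc_self hφ)]
  simp only [← Complex.ofReal_cos, ← Complex.ofReal_sin, h0, h1]

lemma lintegral_polar (x : Plane) {f : Plane → ℝ≥0∞} (hf : Measurable f) :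
    ∫⁻ y, f y = ∫⁻ θ in Set.Ioo (-π) π, ∫⁻ ρ in Set.Ioi (0 : ℝ),
      ENNReal.ofReal ρ * f (x + ρ • unitVec θ) := by
  have hmp : MeasurePreserving (fun p : ℝ × ℝ => (!₂[p.1, p.2] : Plane)) := by
    have h1 := (PiLp.volume_preserving_toLp (Fin 2)).comp
      ((volume_preserving_finTwoArrow ℝ).symm)
    exact h1
  have hm : Measurable fun p : ℝ × ℝ => ENNReal.ofReal p.1 * f (x + p.1 • unitVec p.2) := by
    have : Measurable fun p : ℝ × ℝ => x + p.1 • unitVec p.2 :=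
      (continuous_const.add
        (continuous_fst.smul (continuous_unitVec.comp continuous_snd))).measurable
    exact (ENNReal.measurable_ofReal.comp measurable_fst).mul (hf.comp this)
  calc ∫⁻ y, f y = ∫⁻ y, f (x + y) := (lintegral_add_left_eq_self f x).symm
    _ = ∫⁻ p : ℝ × ℝ, f (x + !₂[p.1, p.2]) :=
        (hmp.lintegral_comp (hf.comp (measurable_const_add x))).symm
    _ = ∫⁻ p in Set.Ioi (0 : ℝ) ×ˢ Set.Ioo (-π) π,
          ENNReal.ofReal p.1 * f (x + p.1 • unitVec p.2) := by
        rw [← lintegral_comp_polarCoord_symm]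
        refine lintegral_congr fun p => ?_
        simp only [polarCoord_symm_apply, smul_eq_mul]
        congr 3
        ext i
        fin_cases i <;> simp [unitVec]
    _ = _ := by
        rw [Measure.volume_eq_prod, ← Measure.prod_restrict, lintegral_prod_symm _ hm.aemeasurable]

lemma enorm_sub_le_lintegral_fderiv_segment {v : Plane → ℝ} {x e : Plane} (he : ‖e‖ = 1) {s : ℝ}
    (hs : 0 ≤ s) (hd : ∀ t ∈ Set.Icc 0 s, DifferentiableAt ℝ v (x + t • e)) :
    ‖v (x + s • e) - v x‖ₑ ≤ ∫⁻ t in Set.Ioo 0 s, ‖fderiv ℝ v (x + t • e)‖ₑ := by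
  rw [setLIntegral_congr Ioo_ae_eq_Ioc]
  by_cases hfin : ∫⁻ t in Set.Ioc 0 s, ‖fderiv ℝ v (x + t • e)‖ₑ = ∞
  · simp [hfin]
  have hline : Measurable fun t : ℝ => x + t • e :=
    (continuous_const.add (continuous_id.smul continuous_const)).measurable
  have hbound : ∀ t : ℝ, ‖fderiv ℝ v (x + t • e) e‖ₑ ≤ ‖fderiv ℝ v (x + t • e)‖ₑ := fun t => by
    rw [enorm_le_iff_norm_le]
    simpa [he] using (fderiv ℝ v (x + t • e)).le_opNorm e
  have hmeas : Measurable fun t : ℝ => fderiv ℝ v (x + t • e) e :=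
    (measurable_fderiv_apply_const ℝ v e).comp hline
  have hderiv : ∀ t ∈ Set.uIcc 0 s,
      HasDerivAt (fun t : ℝ => v (x + t • e)) (fderiv ℝ v (x + t • e) e) t := by
    intro t ht
    rw [Set.uIcc_of_le hs] at ht
    have h1 : HasDerivAt (fun t : ℝ => x + t • e) e t := by
      simpa using ((hasDerivAt_id t).smul_const e).const_add x
    exact (hd t ht).hasFDerivAt.comp_hasDerivAt t h1
  have hInt : IntervalIntegrable (fun t : ℝ => fderiv ℝ v (x + t • e) e) volume 0 s := by
    rw [intervalIntegrable_iff_integrableOn_Ioc_of_le hs]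
    refine ⟨hmeas.aestronglyMeasurable, ?_⟩
    exact (lintegral_mono hbound).trans_lt (lt_top_iff_ne_top.2 hfin)
  have hftc := intervalIntegral.integral_eq_sub_of_hasDerivAt hderiv hInt
  simp only [zero_smul, add_zero] at hftc
  rw [← hftc, intervalIntegral.integral_of_le hs]
  exact (enorm_integral_le_lintegral_enorm _).trans (lintegral_mono hbound)

lemma ae_ray_ne_zero {x : Plane} (hx : x ≠ 0) :
    ∀ᵐ θ ∂(volume.restrict (Set.Ioo (-π) π)), ∀ t : ℝ, 0 ≤ t → x + t • unitVec θ ≠ 0 := by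
  have hsub : {θ ∈ Set.Ioo (-π) π | ∃ t : ℝ, 0 ≤ t ∧ x + t • unitVec θ = 0}.Subsingleton := by
    rintro θ ⟨hθ, t, ht, h⟩ φ ⟨hφ, s, hs, h'⟩
    apply injOn_unitVec hθ hφ
    have ha : x = -(t • unitVec θ) := eq_neg_of_add_eq_zero_left h
    have hb : x = -(s • unitVec φ) := eq_neg_of_add_eq_zero_left h'
    have ha' : ‖x‖ = t := by
      rw [ha, norm_neg, norm_smul, norm_unitVec, mul_one, Real.norm_of_nonneg ht]
    have hb' : ‖x‖ = s := by
      rw [hb, norm_neg, norm_smul, norm_unitVec, mul_one, Real.norm_of_nonneg hs]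
    have hts : t = s := ha'.symm.trans hb'
    have ht0 : t ≠ 0 := ha' ▸ norm_ne_zero_iff.2 hx
    have : t • unitVec θ = t • unitVec φ := by
      have := ha.symm.trans hb
      rw [← hts] at this
      exact neg_injective this
    exact smul_right_injective _ ht0 this
  have hnull := hsub.measure_zero (μ := volume)
  rw [ae_restrict_iff' measurableSet_Ioo]
  rw [← compl_mem_ae_iff] at hnull
  filter_upwards [hnull] with θ hθ hmem t ht h0
  exact hθ ⟨hmem, t, ht, h0⟩

lemma lintegral_Ioo_ofReal {d : ℝ} (hd : 0 ≤ d) :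
    ∫⁻ ρ in Set.Ioo 0 d, ENNReal.ofReal ρ = ENNReal.ofReal (d ^ 2 / 2) := by
  rw [setLIntegral_congr Ioo_ae_eq_Ioc, ← ofReal_integral_eq_lintegral_ofReal,
    ← intervalIntegral.integral_of_le hd, integral_id]
  · simp
  · exact (continuous_id.intervalIntegrable 0 d).1
  · filter_upwards [ae_restrict_mem measurableSet_Ioc] with ρ hρ using hρ.1.le

lemma lintegral_polar_potential (x : Plane) {g : Plane → ℝ≥0∞} (hg : Measurable g) :
    ∫⁻ y, g y * ‖y - x‖ₑ⁻¹ =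
      ∫⁻ θ in Set.Ioo (-π) π, ∫⁻ ρ in Set.Ioi (0 : ℝ), g (x + ρ • unitVec θ) := by
  have hk : Measurable fun y : Plane => ‖y - x‖ₑ⁻¹ := by fun_prop
  rw [lintegral_polar x (f := fun y => g y * ‖y - x‖ₑ⁻¹) (hg.mul hk)]
  refine lintegral_congr fun θ => setLIntegral_congr_fun measurableSet_Ioi fun ρ hρ => ?_
  have hρ' : 0 < ρ := hρ
  have h1 : ‖x + ρ • unitVec θ - x‖ₑ = ENNReal.ofReal ρ := by
    rw [← ofReal_norm, norm_add_smul_unitVec_sub x hρ'.le]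
  simp only [h1]
  rw [mul_comm, mul_assoc, ENNReal.inv_mul_cancel (by simpa using hρ') ENNReal.ofReal_ne_top,
    mul_one]

lemma lintegral_osc_le {v : Plane → ℝ} (hv : Measurable v)
    (hd : ∀ y, y ≠ 0 → DifferentiableAt ℝ v y) {B : Set Plane} (hB : MeasurableSet B)
    (hconv : Convex ℝ B) {x : Plane} (hxB : x ∈ B) (hx : x ≠ 0) {d : ℝ} (hd0 : 0 ≤ d)
    (hBd : B ⊆ Metric.ball x d) :
    ∫⁻ y in B, ‖v y - v x‖ₑ ≤
      ENNReal.ofReal (d ^ 2 / 2) * ∫⁻ y in B, ‖fderiv ℝ v y‖ₑ * ‖y - x‖ₑ⁻¹ := by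
  set g : Plane → ℝ≥0∞ := B.indicator fun y => ‖fderiv ℝ v y‖ₑ with hgdef
  have hg : Measurable g := (measurable_fderiv ℝ v).enorm.indicator hB
  have hline : ∀ θ : ℝ, Measurable fun t : ℝ => x + t • unitVec θ := fun θ =>
    (continuous_const.add (continuous_id.smul continuous_const)).measurable
  have hrhs : ∫⁻ y in B, ‖fderiv ℝ v y‖ₑ * ‖y - x‖ₑ⁻¹ = ∫⁻ y, g y * ‖y - x‖ₑ⁻¹ := by
    rw [← lintegral_indicator hB]
    refine lintegral_congr fun y => ?_
    by_cases hy : y ∈ B <;> simp [hgdef, hy]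
  rw [hrhs, lintegral_polar_potential x hg, ← lintegral_indicator hB,
    lintegral_polar x ((hv.sub_const _).enorm.indicator hB),
    ← lintegral_const_mul' _ _ ENNReal.ofReal_ne_top]
  refine lintegral_mono_ae ?_
  filter_upwards [ae_ray_ne_zero hx] with θ hθ
  rw [← lintegral_Ioo_ofReal hd0, ← lintegral_mul_const _ ENNReal.measurable_ofReal,
    ← lintegral_indicator measurableSet_Ioi, ← lintegral_indicator measurableSet_Ioo]
  refine lintegral_mono fun ρ => ?_
  by_cases hρ : 0 < ρ
  swap
  · simp [hρ]
  by_cases hmem : x + ρ • unitVec θ ∈ B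
  swap
  · simp [Set.indicator, hmem]
  have hρd : ρ < d := by
    have := hBd hmem
    rwa [Metric.mem_ball, dist_eq_norm, norm_add_smul_unitVec_sub x hρ.le] at this
  simp only [Set.mem_Ioi, hρ, Set.indicator_of_mem, hmem, Set.mem_Ioo, hρd, and_self]
  gcongr
  refine (enorm_sub_le_lintegral_fderiv_segment (norm_unitVec θ) hρ.le
    fun t ht => hd _ (hθ t ht.1)).trans ?_
  calc ∫⁻ t in Set.Ioo 0 ρ, ‖fderiv ℝ v (x + t • unitVec θ)‖ₑ
      ≤ ∫⁻ t in Set.Ioo 0 ρ, g (x + t • unitVec θ) := by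
        refine setLIntegral_mono (hg.comp (hline θ)) fun t ht => ?_
        have : x + t • unitVec θ ∈ B := by
          have := hconv.add_smul_sub_mem hxB hmem
            (t := t / ρ) ⟨div_nonneg ht.1.le hρ.le, (div_le_one hρ).2 ht.2.le⟩
          rwa [add_sub_cancel_left, smul_smul, div_mul_cancel₀ _ hρ.ne'] at this
        simp [hgdef, this]
    _ ≤ _ := lintegral_mono_set Set.Ioo_subset_Ioi_self

lemma lintegral_radial (x : Plane) {f : ℝ → ℝ≥0∞} (hf : Measurable f) :
    ∫⁻ y : Plane, f ‖y - x‖ =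
      ENNReal.ofReal (2 * π) * ∫⁻ ρ in Set.Ioi (0 : ℝ), ENNReal.ofReal ρ * f ρ := by
  have hm : Measurable fun y : Plane => f ‖y - x‖ := by fun_prop
  rw [lintegral_polar x hm]
  have : ∀ θ : ℝ, ∫⁻ ρ in Set.Ioi (0 : ℝ), ENNReal.ofReal ρ * f ‖x + ρ • unitVec θ - x‖ =
      ∫⁻ ρ in Set.Ioi (0 : ℝ), ENNReal.ofReal ρ * f ρ := fun θ =>
    setLIntegral_congr_fun measurableSet_Ioi fun ρ hρ => by
      simp only [norm_add_smul_unitVec_sub x (le_of_lt hρ)]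
  simp only [this, lintegral_const, Measure.restrict_apply MeasurableSet.univ, Set.univ_inter,
    Real.volume_Ioo]
  rw [mul_comm]
  congr 2
  ring

/-- The truncated Riesz-type kernel `|z|^{-(1+α)}` on the ball of radius `R`. -/
def rieszKernel (α R : ℝ) (z : Plane) : ℝ≥0∞ :=
  (Metric.ball (0 : Plane) R).indicator (fun z => ‖z‖ₑ ^ (-(1 + α))) z

lemma measurable_rieszKernel (α R : ℝ) : Measurable (rieszKernel α R) :=
  (measurable_enorm.pow_const _).indicator measurableSet_ball

lemma lintegral_rieszKernel_ne_top {α : ℝ} (hα : α < 1) (R : ℝ) :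
    ∫⁻ z, rieszKernel α R z ≠ ∞ := by
  set f : ℝ → ℝ≥0∞ := (Set.Ioo (-R) R).indicator fun ρ => ENNReal.ofReal ρ ^ (-(1 + α)) with hf
  have hfm : Measurable f := by
    refine Measurable.indicator ?_ measurableSet_Ioo
    fun_prop
  have h1 : ∀ z : Plane, rieszKernel α R z = f ‖z - 0‖ := by
    intro z
    have h0 : -R < ‖z‖ ∧ ‖z‖ < R ↔ ‖z‖ < R :=
      ⟨fun h => h.2, fun h => ⟨by linarith [norm_nonneg z], h⟩⟩
    simp [rieszKernel, hf, Set.indicator, h0]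
  simp only [h1]
  rw [lintegral_radial 0 hfm]
  refine ENNReal.mul_ne_top ENNReal.ofReal_ne_top ?_
  have h2 : IntegrableOn (fun ρ : ℝ => ρ ^ (-α)) (Set.Ioo 0 (max R 1)) :=
    (intervalIntegral.integrableOn_Ioo_rpow_iff (by positivity)).2 (by linarith)
  refine ne_top_of_le_ne_top h2.2.ne ?_
  rw [← lintegral_indicator measurableSet_Ioi, ← lintegral_indicator measurableSet_Ioo]
  refine lintegral_mono fun ρ => ?_
  by_cases hρ : 0 < ρ
  swap
  · simp [hρ]
  by_cases hR : ρ < R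
  swap
  · simp [hf, Set.indicator, hR]
  have hR1 : 0 < ρ ∧ (ρ < R ∨ ρ < 1) := ⟨hρ, Or.inl hR⟩
  have hR2 : -R < ρ := by linarith
  simp only [hf, Set.indicator, Set.mem_Ioi, Set.mem_Ioo, hρ, hR, hR2, lt_max_iff, true_or,
    and_self, if_true]
  rw [ENNReal.ofReal_rpow_of_pos hρ, ← ENNReal.ofReal_mul hρ.le, ← ofReal_norm,
    Real.norm_of_nonneg (by positivity)]
  refine ENNReal.ofReal_le_ofReal (le_of_eq ?_)
  rw [show -α = 1 + -(1 + α) by ring, Real.rpow_add hρ, Real.rpow_one]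

lemma volume_ball_plane (x : Plane) {R : ℝ} (hR : 0 ≤ R) :
    volume (Metric.ball x R) = ENNReal.ofReal (π * R ^ 2) := by
  rw [EuclideanSpace.volume_ball_fin_two, mul_comm, ← ENNReal.ofReal_pow hR]
  rw [ENNReal.ofReal_mul pi_pos.le]

lemma lintegral_log_kernel_le (x : Plane) {r : ℝ} (hr : 0 < r) (hr1 : r ≤ 1) :
    ∫⁻ y in Metric.ball x 1 \ Metric.ball x r, ENNReal.ofReal ((‖y - x‖⁻¹) ^ 2) ≤
      ENNReal.ofReal (2 * π * Real.log (1 / r)) := by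
  set f : ℝ → ℝ≥0∞ := (Set.Ico r 1).indicator fun ρ => ENNReal.ofReal ((ρ⁻¹) ^ 2) with hf
  have hfm : Measurable f := by
    refine Measurable.indicator ?_ measurableSet_Ico
    fun_prop
  rw [← lintegral_indicator (measurableSet_ball.diff measurableSet_ball)]
  have h1 : ∀ y : Plane, (Metric.ball x 1 \ Metric.ball x r).indicator
      (fun y => ENNReal.ofReal ((‖y - x‖⁻¹) ^ 2)) y = f ‖y - x‖ := by
    intro y
    simp [hf, Set.indicator, dist_eq_norm, and_comm]
  simp only [h1]
  rw [lintegral_radial x hfm, ENNReal.ofReal_mul (p := 2 * π) (by positivity)]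
  gcongr
  have h2 : IntervalIntegrable (fun ρ : ℝ => ρ⁻¹) volume r 1 := by
    refine ContinuousOn.intervalIntegrable ?_
    refine continuousOn_inv₀.mono fun ρ hρ => ?_
    rw [Set.uIcc_of_le hr1] at hρ
    exact (hr.trans_le hρ.1).ne'
  have h3 : ∫⁻ ρ in Set.Ioc r 1, ENNReal.ofReal (ρ⁻¹) = ENNReal.ofReal (Real.log (1 / r)) := by
    rw [← ofReal_integral_eq_lintegral_ofReal h2.1, ← intervalIntegral.integral_of_le hr1,
      integral_inv_of_pos hr one_pos]
    filter_upwards [ae_restrict_mem measurableSet_Ioc] with ρ hρ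
      using (inv_pos.2 (hr.trans hρ.1)).le
  rw [← h3, ← setLIntegral_congr Ico_ae_eq_Ioc, ← lintegral_indicator measurableSet_Ioi,
    ← lintegral_indicator measurableSet_Ico]
  refine lintegral_mono fun ρ => ?_
  by_cases hρ : ρ ∈ Set.Ico r 1
  swap
  · simp [hf, Set.indicator, hρ]
  have hρ0 : 0 < ρ := hr.trans_le hρ.1
  simp only [hf, hρ, Set.indicator_of_mem, Set.mem_Ioi, hρ0]
  rw [← ENNReal.ofReal_mul hρ0.le]
  refine ENNReal.ofReal_le_ofReal (le_of_eq ?_)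
  field_simp

lemma sq_lintegral_mul_le {X : Type*} [MeasurableSpace X] (m : Measure X) {g k : X → ℝ≥0∞}
    (hg : Measurable g) (hk : Measurable k) :
    (∫⁻ y, g y * k y ∂m) ^ 2 ≤ (∫⁻ y, k y ∂m) * ∫⁻ y, g y ^ 2 * k y ∂m := by
  have h := ENNReal.lintegral_mul_norm_pow_le (μ := m) (p := 1 / 2) (q := 1 / 2)
    hk.aemeasurable ((hg.pow_const 2).mul hk).aemeasurable (by norm_num) (by norm_num) (by norm_num)
  have h1 : ∀ y, k y ^ (1 / 2 : ℝ) * (g y ^ 2 * k y) ^ (1 / 2 : ℝ) = g y * k y := by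
    intro y
    rw [ENNReal.mul_rpow_of_nonneg _ _ (by norm_num), ← ENNReal.rpow_natCast, ← ENNReal.rpow_mul,
      mul_left_comm, ← ENNReal.rpow_add_of_nonneg _ _ (by norm_num) (by norm_num)]
    norm_num
  simp only [Pi.mul_apply, h1] at h
  calc (∫⁻ y, g y * k y ∂m) ^ 2
      ≤ ((∫⁻ y, k y ∂m) ^ (1 / 2 : ℝ) * (∫⁻ y, g y ^ 2 * k y ∂m) ^ (1 / 2 : ℝ)) ^ 2 := by
        gcongr
    _ = _ := by
        rw [mul_pow, ← ENNReal.rpow_natCast, ← ENNReal.rpow_natCast, ← ENNReal.rpow_mul,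
          ← ENNReal.rpow_mul]
        norm_num

lemma lintegral_sq_convolution_le {g k : Plane → ℝ≥0∞} (hg : Measurable g) (hk : Measurable k) :
    ∫⁻ x, (∫⁻ y, g y * k (y - x)) ^ 2 ≤ (∫⁻ z, k z) ^ 2 * ∫⁻ y, g y ^ 2 := by
  have hk2 : Measurable fun p : Plane × Plane => k (p.2 - p.1) :=
    hk.comp (measurable_snd.sub measurable_fst)
  calc ∫⁻ x, (∫⁻ y, g y * k (y - x)) ^ 2
      ≤ ∫⁻ x, (∫⁻ z, k z) * ∫⁻ y, g y ^ 2 * k (y - x) := by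
        refine lintegral_mono fun x => ?_
        refine (sq_lintegral_mul_le volume hg (hk.comp (measurable_id.sub_const x))).trans_eq ?_
        simp only [Function.comp_apply, id, lintegral_sub_right_eq_self]
    _ = (∫⁻ z, k z) * ∫⁻ x, ∫⁻ y, g y ^ 2 * k (y - x) := by
        refine lintegral_const_mul _ ?_
        exact (((hg.comp measurable_snd).pow_const 2).mul hk2).lintegral_prod_right'
    _ = (∫⁻ z, k z) * ∫⁻ y, g y ^ 2 * ∫⁻ z, k z := by
        congr 1
        rw [lintegral_lintegral_swap
          (((hg.comp measurable_snd).pow_const 2).mul hk2).aemeasurable]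
        refine lintegral_congr fun y => ?_
        have hky : Measurable fun x => k (y - x) := hk.comp (measurable_id.const_sub y)
        rw [lintegral_const_mul _ hky, lintegral_sub_left_eq_self]
    _ = _ := by
        rw [lintegral_mul_const _ (hg.pow_const 2)]
        ring

lemma setLIntegral_le_lintegral_rieszKernel {B : Set Plane} (hB : MeasurableSet B)
    {N : Plane → ℝ≥0∞} {z : Plane} {R : ℝ} (hBz : B ⊆ Metric.ball z R) :
    ∫⁻ y in B, N y * ‖y - z‖ₑ⁻¹ ≤ ∫⁻ y, B.indicator N y * rieszKernel 0 R (y - z) := by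
  rw [← lintegral_indicator hB]
  refine lintegral_mono fun y => ?_
  by_cases hy : y ∈ B
  · have h1 : ‖y - z‖ < R := by simpa [dist_eq_norm] using hBz hy
    simp [hy, rieszKernel, h1, ENNReal.rpow_neg_one]
  · simp [hy]

lemma setLIntegral_le_of_sq_le {X : Type*} [MeasurableSpace X] {m : Measure X} {B : Set X}
    {N : X → ℝ≥0∞} {D V : ℝ} (hD : 0 < D) (hV : 0 ≤ V) (hBV : m B ≤ ENNReal.ofReal V)
    (hN : Measurable N) (hE : ∫⁻ y in B, N y ^ 2 ∂m ≤ ENNReal.ofReal (D ^ 2)) :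
    ∫⁻ y in B, N y ∂m ≤ ENNReal.ofReal ((1 + V) * D) := by
  have hpt : ∀ y, N y ≤ ENNReal.ofReal (1 / D) * N y ^ 2 + ENNReal.ofReal D := by
    intro y
    by_cases htop : N y = ∞
    · simp [htop, ENNReal.mul_top, hD]
    lift N y to NNReal using htop with n
    rw [← ENNReal.ofReal_coe_nnreal, ← ENNReal.ofReal_pow n.coe_nonneg,
      ← ENNReal.ofReal_mul (by positivity), ← ENNReal.ofReal_add (by positivity) hD.le]
    refine ENNReal.ofReal_le_ofReal ?_
    rcases le_total (n : ℝ) D with h | h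
    · have : 0 ≤ 1 / D * (n : ℝ) ^ 2 := by positivity
      linarith
    · have : (n : ℝ) ≤ 1 / D * (n : ℝ) ^ 2 := by
        rw [one_div, ← div_eq_inv_mul, le_div_iff₀ hD]
        nlinarith [n.coe_nonneg]
      linarith
  calc ∫⁻ y in B, N y ∂m ≤ ∫⁻ y in B, (ENNReal.ofReal (1 / D) * N y ^ 2 + ENNReal.ofReal D) ∂m :=
        lintegral_mono hpt
    _ = ENNReal.ofReal (1 / D) * ∫⁻ y in B, N y ^ 2 ∂m + ENNReal.ofReal D * m B := by
        rw [lintegral_add_right _ measurable_const, lintegral_const_mul _ (hN.pow_const 2),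
          setLIntegral_const]
    _ ≤ ENNReal.ofReal (1 / D) * ENNReal.ofReal (D ^ 2) + ENNReal.ofReal D * ENNReal.ofReal V := by
        gcongr
    _ = _ := by
        rw [← ENNReal.ofReal_mul (by positivity), ← ENNReal.ofReal_mul hD.le,
          ← ENNReal.ofReal_add (by positivity) (by positivity)]
        congr 1
        field_simp

lemma exists_const_lintegral_sub_le : ∃ M : ℝ, 0 ≤ M ∧ ∀ (v : Plane → ℝ) (D : ℝ), Measurable v →
    (∀ y, y ≠ 0 → DifferentiableAt ℝ v y) → 0 < D →
    ∫⁻ y in Metric.ball (0 : Plane) 3, ‖fderiv ℝ v y‖ₑ ^ 2 ≤ ENNReal.ofReal (D ^ 2) →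
    ∃ c : ℝ, ∫⁻ y in Metric.ball (0 : Plane) 3, ‖v y - c‖ₑ ≤ ENNReal.ofReal (M * D) := by
  set K := ∫⁻ z, rieszKernel 0 6 z
  have hKtop : K ≠ ∞ := lintegral_rieszKernel_ne_top one_pos 6
  set B : Set Plane := Metric.ball (0 : Plane) 3 with hBdef
  have hBvol : volume B = ENNReal.ofReal (π * 3 ^ 2) := volume_ball_plane 0 (by norm_num)
  refine ⟨18 * ((1 + π * 3 ^ 2) * K.toReal) / (π * 3 ^ 2), by positivity, ?_⟩
  intro v D hv hd hD hE
  have hN : Measurable fun y => ‖fderiv ℝ v y‖ₑ := (measurable_fderiv ℝ v).enorm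
  set g : Plane → ℝ≥0∞ := B.indicator fun y => ‖fderiv ℝ v y‖ₑ
  have hg : Measurable g := hN.indicator measurableSet_ball
  have hk2 : Measurable fun p : Plane × Plane => rieszKernel 0 6 (p.2 - p.1) :=
    (measurable_rieszKernel 0 6).comp (measurable_snd.sub measurable_fst)
  have hdouble : ∫⁻ z in B, ∫⁻ y in B, ‖v y - v z‖ₑ ≤
      ENNReal.ofReal (18 * ((1 + π * 3 ^ 2) * D * K.toReal)) := by
    calc ∫⁻ z in B, ∫⁻ y in B, ‖v y - v z‖ₑ
        ≤ ∫⁻ z in B, ENNReal.ofReal 18 * ∫⁻ y, g y * rieszKernel 0 6 (y - z) := by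
          refine lintegral_mono_ae ?_
          filter_upwards [ae_restrict_mem measurableSet_ball,
            ae_restrict_of_ae (Measure.ae_ne volume (0 : Plane))] with z hz hz0
          have hBz : B ⊆ Metric.ball z 6 := by
            intro y hy
            rw [hBdef, mem_ball_zero_iff] at hy hz
            rw [Metric.mem_ball, dist_eq_norm]
            linarith [norm_sub_le y z]
          refine (lintegral_osc_le hv hd measurableSet_ball (convex_ball _ _) hz hz0
            (by norm_num) hBz).trans ?_
          norm_num only
          exact mul_le_mul_right
            (setLIntegral_le_lintegral_rieszKernel measurableSet_ball hBz) _
      _ ≤ ENNReal.ofReal 18 * ∫⁻ z, ∫⁻ y, g y * rieszKernel 0 6 (y - z) := by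
          rw [lintegral_const_mul' _ _ ENNReal.ofReal_ne_top]
          gcongr
          exact Measure.restrict_le_self
      _ = ENNReal.ofReal 18 * ((∫⁻ y in B, ‖fderiv ℝ v y‖ₑ) * K) := by
          rw [lintegral_lintegral_swap ((hg.comp measurable_snd).mul hk2).aemeasurable,
            ← lintegral_indicator measurableSet_ball, ← lintegral_mul_const _ hg]
          congr 1
          refine lintegral_congr fun y => ?_
          have hky : Measurable fun z => rieszKernel 0 6 (y - z) :=
            (measurable_rieszKernel 0 6).comp (measurable_id.const_sub y)
          rw [lintegral_const_mul _ hky,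
            lintegral_sub_left_eq_self (rieszKernel 0 6)]
      _ ≤ ENNReal.ofReal 18 * (ENNReal.ofReal ((1 + π * 3 ^ 2) * D) * ENNReal.ofReal K.toReal) := by
          rw [ENNReal.ofReal_toReal hKtop]
          gcongr
          exact setLIntegral_le_of_sq_le hD (by positivity) hBvol.le hN hE
      _ = _ := by
          rw [← ENNReal.ofReal_mul (by positivity), ← ENNReal.ofReal_mul (by positivity)]
  have hmeas : Measurable fun z => ∫⁻ y in B, ‖v y - v z‖ₑ := by
    have : Measurable fun p : Plane × Plane => ‖v p.2 - v p.1‖ₑ :=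
      ((hv.comp measurable_snd).sub (hv.comp measurable_fst)).enorm
    exact this.lintegral_prod_right'
  obtain ⟨z, -, hz⟩ := exists_le_setLAverage (μ := volume) (s := B)
    (by rw [hBvol]; simp [pi_pos]) (by rw [hBvol]; exact ENNReal.ofReal_ne_top)
    hmeas.aemeasurable
  refine ⟨v z, hz.trans ?_⟩
  rw [setLAverage_eq, hBvol]
  refine (ENNReal.div_le_div_right hdouble _).trans ?_
  rw [← ENNReal.ofReal_div_of_pos (by positivity)]
  refine ENNReal.ofReal_le_ofReal (le_of_eq ?_)
  ring

lemma exp_le_of_forall_scale {a t M D α G : ℝ} (ha : 0 ≤ a) (hM : 0 ≤ M) (hD : 0 < D) (hα : 0 < α)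
    (h : ∀ r : ℝ, 0 < r → r ≤ 1 → π * (a * t) ≤ a * (M * D) + 1 / 2 * (a * (r ^ α * G)) +
      1 / 2 * (a ^ 2 * D ^ 2 / (8 * α) + 4 * π * α * Real.log (1 / r))) :
    Real.exp (a * t) ≤
      Real.exp ((M + 1) * (a * D) + a ^ 2 * D ^ 2 / (16 * π * α)) * (1 + (G / D) ^ 2) := by
  have hpi : 1 ≤ π := by linarith [pi_gt_three]
  have haD : 0 ≤ a * D := by positivity
  have key : ∀ l : ℝ, 0 ≤ l → π * (a * t) ≤ a * (M * D) + 1 / 2 * (a * D) +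
      1 / 2 * (a ^ 2 * D ^ 2 / (8 * α) + 4 * π * l) →
      a * t ≤ (M + 1) * (a * D) + a ^ 2 * D ^ 2 / (16 * π * α) + 2 * l := by
    intro l hl hle
    have h1 : a ^ 2 * D ^ 2 / (16 * π * α) * π = 1 / 2 * (a ^ 2 * D ^ 2 / (8 * α)) := by
      field_simp
      ring
    have h2 : (M + 1) * (a * D) ≤ (M + 1) * (a * D) * π :=
      le_mul_of_one_le_right (by positivity) hpi
    refine le_of_mul_le_mul_left ?_ pi_pos
    nlinarith
  rcases le_or_gt G D with hGD | hGD
  · have h1 := h 1 one_pos le_rfl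
    have h2 := key 0 le_rfl (by
      simp only [Real.one_rpow, one_mul, div_one, Real.log_one, mul_zero] at h1 ⊢
      nlinarith [mul_le_mul_of_nonneg_left hGD ha])
    refine (Real.exp_le_exp.2 (h2.trans_eq (by rw [mul_zero, add_zero]))).trans ?_
    exact le_mul_of_one_le_right (Real.exp_pos _).le (by nlinarith [sq_nonneg (G / D)])
  · have hG : 0 < G := hD.trans hGD
    have hq : 0 < D / G := by positivity
    have h1 := h ((D / G) ^ (1 / α)) (by positivity)
      (Real.rpow_le_one hq.le ((div_le_one hG).2 hGD.le) (by positivity))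
    have hr : ((D / G) ^ (1 / α)) ^ α * G = D := by
      rw [← Real.rpow_mul hq.le, one_div, inv_mul_cancel₀ hα.ne', Real.rpow_one]
      field_simp
    have hl : 4 * π * α * Real.log (1 / (D / G) ^ (1 / α)) = 4 * π * Real.log (G / D) := by
      rw [one_div, Real.log_inv, Real.log_rpow hq, ← inv_div G D, Real.log_inv]
      field_simp
    rw [hr, hl] at h1
    have h2 := key (Real.log (G / D)) (Real.log_nonneg ((one_le_div hD).2 hGD.le)) h1
    refine (Real.exp_le_exp.2 h2).trans ?_
    rw [Real.exp_add]
    gcongr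
    rw [two_mul, Real.exp_add, Real.exp_log (by positivity)]
    nlinarith

lemma lintegral_annulus_le {v : Plane → ℝ} {D α a r : ℝ} (hα : 0 < α) (ha : 0 ≤ a) (hr : 0 < r)
    (hr1 : r ≤ 1) {x : Plane}
    (hE : ∫⁻ y in Metric.ball x 1, ‖fderiv ℝ v y‖ₑ ^ 2 ≤ ENNReal.ofReal (D ^ 2)) :
    ENNReal.ofReal a *
        ∫⁻ y in Metric.ball x 1 \ Metric.ball x r, ‖fderiv ℝ v y‖ₑ * ‖y - x‖ₑ⁻¹ ≤
      ENNReal.ofReal (a ^ 2 * D ^ 2 / (8 * α) + 4 * π * α * Real.log (1 / r)) := by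
  have hlog : 0 ≤ Real.log (1 / r) := Real.log_nonneg ((one_le_div hr).2 hr1)
  set A := Metric.ball x 1 \ Metric.ball x r
  have hAm : MeasurableSet A := measurableSet_ball.diff measurableSet_ball
  have hN : Measurable fun y => ‖fderiv ℝ v y‖ₑ := (measurable_fderiv ℝ v).enorm
  have hpt : ∀ y ∈ A, ENNReal.ofReal a * (‖fderiv ℝ v y‖ₑ * ‖y - x‖ₑ⁻¹) ≤
      ENNReal.ofReal (a ^ 2 / (8 * α)) * ‖fderiv ℝ v y‖ₑ ^ 2 +
        ENNReal.ofReal (2 * α) * ENNReal.ofReal ((‖y - x‖⁻¹) ^ 2) := by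
    intro y hy
    have hpos : 0 < ‖y - x‖ := by
      have : r ≤ ‖y - x‖ := by simpa [dist_eq_norm] using hy.2
      linarith
    rw [← ofReal_norm, ← ofReal_norm, ← ENNReal.ofReal_inv_of_pos hpos,
      ← ENNReal.ofReal_mul (by positivity), ← ENNReal.ofReal_mul ha,
      ← ENNReal.ofReal_pow (by positivity), ← ENNReal.ofReal_mul (by positivity),
      ← ENNReal.ofReal_mul (by positivity), ← ENNReal.ofReal_add (by positivity) (by positivity)]
    refine ENNReal.ofReal_le_ofReal ?_
    have h := sq_nonneg (a * ‖fderiv ℝ v y‖ - 4 * α * ‖y - x‖⁻¹)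
    rw [← sub_nonneg]
    calc 0 ≤ (a * ‖fderiv ℝ v y‖ - 4 * α * ‖y - x‖⁻¹) ^ 2 / (8 * α) := by positivity
      _ = _ := by
        field_simp
        ring
  rw [← lintegral_const_mul' _ _ ENNReal.ofReal_ne_top]
  calc _ ≤ ∫⁻ y in A, (ENNReal.ofReal (a ^ 2 / (8 * α)) * ‖fderiv ℝ v y‖ₑ ^ 2 +
        ENNReal.ofReal (2 * α) * ENNReal.ofReal ((‖y - x‖⁻¹) ^ 2)) := setLIntegral_mono' hAm hpt
    _ = ENNReal.ofReal (a ^ 2 / (8 * α)) * (∫⁻ y in A, ‖fderiv ℝ v y‖ₑ ^ 2) +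
        ENNReal.ofReal (2 * α) * ∫⁻ y in A, ENNReal.ofReal ((‖y - x‖⁻¹) ^ 2) := by
      rw [lintegral_add_left ((hN.pow_const 2).const_mul _),
        lintegral_const_mul' _ _ ENNReal.ofReal_ne_top,
        lintegral_const_mul' _ _ ENNReal.ofReal_ne_top]
    _ ≤ ENNReal.ofReal (a ^ 2 / (8 * α)) * ENNReal.ofReal (D ^ 2) +
        ENNReal.ofReal (2 * α) * ENNReal.ofReal (2 * π * Real.log (1 / r)) := by
      gcongr
      · exact (lintegral_mono_set Set.sdiff_subset).trans hE
      · exact lintegral_log_kernel_le x hr hr1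
    _ = _ := by
      rw [← ENNReal.ofReal_mul (by positivity), ← ENNReal.ofReal_mul (by positivity),
        ← ENNReal.ofReal_add (by positivity) (by positivity)]
      congr 1
      ring

lemma lintegral_inner_ball_le {B : Set Plane} {N : Plane → ℝ≥0∞} {α r : ℝ} (hα : 0 < α)
    (hr : 0 < r) (hr1 : r ≤ 1) {x : Plane} (hB : Metric.ball x 1 ⊆ B) :
    ∫⁻ y in Metric.ball x r, N y * ‖y - x‖ₑ⁻¹ ≤
      ENNReal.ofReal (r ^ α) * ∫⁻ y, B.indicator N y * rieszKernel α 1 (y - x) := by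
  rw [← lintegral_const_mul' _ _ ENNReal.ofReal_ne_top, ← lintegral_indicator measurableSet_ball]
  refine lintegral_mono_ae ?_
  filter_upwards [Measure.ae_ne volume x] with y hyx
  by_cases hy : y ∈ Metric.ball x r
  swap
  · simp [hy]
  have hyr : ‖y - x‖ < r := by simpa [dist_eq_norm] using hy
  have hpos : 0 < ‖y - x‖ := norm_pos_iff.2 (sub_ne_zero.2 hyx)
  have hy1 : ‖y - x‖ < 1 := hyr.trans_le hr1
  have hyB : y ∈ B := hB (Metric.ball_subset_ball hr1 hy)
  have hker : rieszKernel α 1 (y - x) = ENNReal.ofReal (‖y - x‖ ^ (-(1 + α))) := by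
    simp only [rieszKernel, Metric.mem_ball, dist_zero_right, hy1, Set.indicator_of_mem]
    rw [← ofReal_norm, ENNReal.ofReal_rpow_of_pos hpos]
  rw [Set.indicator_of_mem hy, Set.indicator_of_mem hyB, hker, mul_left_comm, ← ofReal_norm,
    ← ENNReal.ofReal_inv_of_pos hpos, ← ENNReal.ofReal_mul (by positivity)]
  gcongr
  rw [neg_add, Real.rpow_add hpos, Real.rpow_neg_one, mul_left_comm]
  refine le_mul_of_one_le_right (by positivity) ?_
  rw [Real.rpow_neg hpos.le, ← div_eq_mul_inv, one_le_div (by positivity)]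
  exact Real.rpow_le_rpow hpos.le hyr.le hα.le

lemma exp_abs_sub_le {v : Plane → ℝ} {D M α a c : ℝ} (hv : Measurable v)
    (hd : ∀ y, y ≠ 0 → DifferentiableAt ℝ v y) (hD : 0 < D) (hM : 0 ≤ M) (hα : 0 < α)
    (ha : 0 ≤ a)
    (hE : ∫⁻ y in Metric.ball (0 : Plane) 3, ‖fderiv ℝ v y‖ₑ ^ 2 ≤ ENNReal.ofReal (D ^ 2))
    (hc : ∫⁻ y in Metric.ball (0 : Plane) 3, ‖v y - c‖ₑ ≤ ENNReal.ofReal (M * D))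
    {x : Plane} (hx : x ∈ Metric.ball (0 : Plane) 2) (hx0 : x ≠ 0) {G : ℝ} (hG0 : 0 ≤ G)
    (hG : ∫⁻ y, (Metric.ball (0 : Plane) 3).indicator (fun y => ‖fderiv ℝ v y‖ₑ) y *
      rieszKernel α 1 (y - x) = ENNReal.ofReal G) :
    Real.exp (a * |v x - c|) ≤
      Real.exp ((M + 1) * (a * D) + a ^ 2 * D ^ 2 / (16 * π * α)) * (1 + (G / D) ^ 2) := by
  have hsub : Metric.ball x 1 ⊆ Metric.ball (0 : Plane) 3 := by
    intro y hy
    rw [mem_ball_zero_iff] at hx ⊢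
    rw [Metric.mem_ball, dist_eq_norm] at hy
    have := norm_add_le (y - x) x
    rw [sub_add_cancel] at this
    linarith
  refine exp_le_of_forall_scale ha hM hD hα fun r hr hr1 => ?_
  have hlog : 0 ≤ Real.log (1 / r) := Real.log_nonneg ((one_le_div hr).2 hr1)
  have hmeas : Measurable fun y => ‖fderiv ℝ v y‖ₑ * ‖y - x‖ₑ⁻¹ :=
    (measurable_fderiv ℝ v).enorm.mul (by fun_prop)
  have hmain : ENNReal.ofReal π * ‖v x - c‖ₑ ≤ ENNReal.ofReal (M * D) +
      ENNReal.ofReal (1 / 2) * (ENNReal.ofReal (r ^ α) * ENNReal.ofReal G +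
        ∫⁻ y in Metric.ball x 1 \ Metric.ball x r, ‖fderiv ℝ v y‖ₑ * ‖y - x‖ₑ⁻¹) := by
    calc ENNReal.ofReal π * ‖v x - c‖ₑ = ∫⁻ y in Metric.ball x 1, ‖v x - c‖ₑ := by
          rw [setLIntegral_const, volume_ball_plane x zero_le_one, mul_comm]
          simp
      _ ≤ ∫⁻ y in Metric.ball x 1, (‖v y - c‖ₑ + ‖v y - v x‖ₑ) := by
          refine lintegral_mono fun y => ?_
          have : v x - c = (v y - c) - (v y - v x) := by ring
          rw [this]
          exact enorm_sub_le
      _ = (∫⁻ y in Metric.ball x 1, ‖v y - c‖ₑ) + ∫⁻ y in Metric.ball x 1, ‖v y - v x‖ₑ :=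
          lintegral_add_left (hv.sub_const c).enorm _
      _ ≤ _ := by
          refine add_le_add ((lintegral_mono_set hsub).trans hc) ?_
          refine (lintegral_osc_le hv hd measurableSet_ball (convex_ball _ _)
            (Metric.mem_ball_self one_pos) hx0 zero_le_one subset_rfl).trans ?_
          rw [one_pow]
          refine mul_le_mul_right ?_ _
          rw [← lintegral_inter_add_sdiff _ (Metric.ball x 1) (measurableSet_ball (x := x) (ε := r)),
            Set.inter_eq_self_of_subset_right (Metric.ball_subset_ball hr1), ← hG]
          gcongr
          exact lintegral_inner_ball_le hα hr hr1 hsub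
  have hann := lintegral_annulus_le hα ha hr hr1 ((lintegral_mono_set hsub).trans hE)
  have hfinal : ENNReal.ofReal (π * (a * |v x - c|)) ≤
      ENNReal.ofReal (a * (M * D) + 1 / 2 * (a * (r ^ α * G)) +
        1 / 2 * (a ^ 2 * D ^ 2 / (8 * α) + 4 * π * α * Real.log (1 / r))) := by
    calc ENNReal.ofReal (π * (a * |v x - c|))
        = ENNReal.ofReal a * (ENNReal.ofReal π * ‖v x - c‖ₑ) := by
          rw [← Real.norm_eq_abs, ← ofReal_norm, ← ENNReal.ofReal_mul pi_pos.le,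
            ← ENNReal.ofReal_mul ha]
          congr 1
          ring
      _ ≤ ENNReal.ofReal a * (ENNReal.ofReal (M * D) +
          ENNReal.ofReal (1 / 2) * (ENNReal.ofReal (r ^ α) * ENNReal.ofReal G +
            ∫⁻ y in Metric.ball x 1 \ Metric.ball x r, ‖fderiv ℝ v y‖ₑ * ‖y - x‖ₑ⁻¹)) := by
          gcongr
      _ = ENNReal.ofReal (a * (M * D) + 1 / 2 * (a * (r ^ α * G))) + ENNReal.ofReal (1 / 2) *
          (ENNReal.ofReal a *
            ∫⁻ y in Metric.ball x 1 \ Metric.ball x r, ‖fderiv ℝ v y‖ₑ * ‖y - x‖ₑ⁻¹) := by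
          rw [ENNReal.ofReal_add (by positivity) (by positivity), ENNReal.ofReal_mul ha,
            ENNReal.ofReal_mul (p := 1 / 2) (by norm_num), ENNReal.ofReal_mul ha,
            ENNReal.ofReal_mul (p := r ^ α) (by positivity)]
          ring
      _ ≤ ENNReal.ofReal (a * (M * D) + 1 / 2 * (a * (r ^ α * G))) + ENNReal.ofReal (1 / 2) *
          ENNReal.ofReal (a ^ 2 * D ^ 2 / (8 * α) + 4 * π * α * Real.log (1 / r)) := by
          gcongr
      _ = _ := by
          rw [← ENNReal.ofReal_mul (by norm_num), ← ENNReal.ofReal_add (by positivity)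
            (by positivity)]
  rwa [ENNReal.ofReal_le_ofReal_iff (by positivity)] at hfinal

/-- Subcritical Trudinger–Moser inequality on a disc, relative to a suitable constant; the function
may be singular at the centre. -/
lemma exists_const_lintegral_exp_le {α : ℝ} (hα : 0 < α) (hα1 : α < 1) :
    ∃ K : ℝ, 0 < K ∧ ∀ (v : Plane → ℝ) (D : ℝ), Measurable v →
      (∀ y, y ≠ 0 → DifferentiableAt ℝ v y) → 0 < D →
      ∫⁻ y in Metric.ball (0 : Plane) 3, ‖fderiv ℝ v y‖ₑ ^ 2 ≤ ENNReal.ofReal (D ^ 2) →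
      ∃ c : ℝ, ∀ a : ℝ, 0 ≤ a →
        ∫⁻ y in Metric.ball (0 : Plane) 2, ENNReal.ofReal (Real.exp (a * |v y - c|)) ≤
          ENNReal.ofReal (K * Real.exp (K * (a * D) + a ^ 2 * D ^ 2 / (16 * π * α))) := by
  obtain ⟨M, hM, hMc⟩ := exists_const_lintegral_sub_le
  set k := ∫⁻ z, rieszKernel α 1 z
  have hktop : k ≠ ∞ := lintegral_rieszKernel_ne_top hα1 1
  refine ⟨M + 1 + (π * 2 ^ 2 + k.toReal ^ 2), by positivity, ?_⟩
  intro v D hv hd hD hE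
  obtain ⟨c, hc⟩ := hMc v D hv hd hD hE
  refine ⟨c, fun a ha => ?_⟩
  have hN : Measurable fun y => ‖fderiv ℝ v y‖ₑ := (measurable_fderiv ℝ v).enorm
  set g : Plane → ℝ≥0∞ := (Metric.ball (0 : Plane) 3).indicator fun y => ‖fderiv ℝ v y‖ₑ
  have hg : Measurable g := hN.indicator measurableSet_ball
  set G : Plane → ℝ≥0∞ := fun x => ∫⁻ y, g y * rieszKernel α 1 (y - x)
  have hGm : Measurable G := by
    have : Measurable fun p : Plane × Plane => g p.2 * rieszKernel α 1 (p.2 - p.1) :=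
      (hg.comp measurable_snd).mul
        ((measurable_rieszKernel α 1).comp (measurable_snd.sub measurable_fst))
    exact this.lintegral_prod_right'
  have hg2 : ∫⁻ y, g y ^ 2 ≤ ENNReal.ofReal (D ^ 2) := by
    refine le_trans (le_of_eq ?_) hE
    rw [← lintegral_indicator measurableSet_ball]
    refine lintegral_congr fun y => ?_
    by_cases hy : y ∈ Metric.ball (0 : Plane) 3 <;> simp [g, Set.indicator, hy]
  have hG2 : ∫⁻ x, G x ^ 2 ≤ ENNReal.ofReal (k.toReal ^ 2 * D ^ 2) := by
    refine (lintegral_sq_convolution_le hg (measurable_rieszKernel α 1)).trans ?_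
    rw [ENNReal.ofReal_mul (by positivity), ENNReal.ofReal_pow (by positivity),
      ENNReal.ofReal_toReal hktop]
    gcongr
  have hGfin : ∀ᵐ x, G x ≠ ∞ := by
    have h := ae_lt_top (hGm.pow_const 2) (ne_top_of_le_ne_top ENNReal.ofReal_ne_top hG2)
    filter_upwards [h] with x hx htop
    simp [htop] at hx
  set Q := Real.exp ((M + 1) * (a * D) + a ^ 2 * D ^ 2 / (16 * π * α)) with hQ
  have hQ0 : 0 < Q := Real.exp_pos _
  have hpt : ∀ᵐ x ∂(volume.restrict (Metric.ball (0 : Plane) 2)),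
      ENNReal.ofReal (Real.exp (a * |v x - c|)) ≤
        ENNReal.ofReal Q * (1 + ENNReal.ofReal (1 / D ^ 2) * G x ^ 2) := by
    filter_upwards [ae_restrict_mem measurableSet_ball, ae_restrict_of_ae hGfin,
      ae_restrict_of_ae (Measure.ae_ne volume (0 : Plane))] with x hx hGx hx0
    have h := exp_abs_sub_le hv hd hD hM hα ha hE hc hx hx0 (G := (G x).toReal)
      ENNReal.toReal_nonneg (ENNReal.ofReal_toReal hGx).symm
    have hsq : ((G x).toReal / D) ^ 2 = 1 / D ^ 2 * (G x).toReal ^ 2 := by field_simp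
    rw [← hQ, hsq] at h
    refine (ENNReal.ofReal_le_ofReal h).trans (le_of_eq ?_)
    rw [ENNReal.ofReal_mul hQ0.le, ENNReal.ofReal_add zero_le_one (by positivity),
      ENNReal.ofReal_one, ENNReal.ofReal_mul (p := 1 / D ^ 2) (by positivity),
      ENNReal.ofReal_pow ENNReal.toReal_nonneg, ENNReal.ofReal_toReal hGx]
  calc _ ≤ ∫⁻ x in Metric.ball (0 : Plane) 2,
          ENNReal.ofReal Q * (1 + ENNReal.ofReal (1 / D ^ 2) * G x ^ 2) := lintegral_mono_ae hpt
    _ = ENNReal.ofReal Q * (volume (Metric.ball (0 : Plane) 2) +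
          ENNReal.ofReal (1 / D ^ 2) * ∫⁻ x in Metric.ball (0 : Plane) 2, G x ^ 2) := by
        rw [lintegral_const_mul' _ _ ENNReal.ofReal_ne_top, lintegral_add_left measurable_const,
          lintegral_const_mul' _ _ ENNReal.ofReal_ne_top, setLIntegral_const, one_mul]
    _ ≤ ENNReal.ofReal Q * (ENNReal.ofReal (π * 2 ^ 2) +
          ENNReal.ofReal (1 / D ^ 2) * ENNReal.ofReal (k.toReal ^ 2 * D ^ 2)) := by
        rw [volume_ball_plane _ zero_le_two]
        gcongr
        exact (setLIntegral_le_lintegral _ _).trans hG2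
    _ = ENNReal.ofReal ((π * 2 ^ 2 + k.toReal ^ 2) * Q) := by
        have hkD : 1 / D ^ 2 * (k.toReal ^ 2 * D ^ 2) = k.toReal ^ 2 := by field_simp
        rw [← ENNReal.ofReal_mul (by positivity), ← ENNReal.ofReal_add (by positivity)
          (by positivity), ← ENNReal.ofReal_mul hQ0.le, hkD, mul_comm]
    _ ≤ _ := by
        refine ENNReal.ofReal_le_ofReal ?_
        have h1 : 0 ≤ π * 2 ^ 2 + k.toReal ^ 2 := by positivity
        have haD : 0 ≤ a * D := by positivity
        refine mul_le_mul (by linarith) (Real.exp_le_exp.2 ?_) hQ0.le (by positivity)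
        have := mul_nonneg h1 haD
        linarith

/-- Inversion in the unit circle. -/
def planeInv : Plane → Plane := EuclideanGeometry.inversion 0 1

lemma norm_planeInv (y : Plane) : ‖planeInv y‖ = ‖y‖⁻¹ := by
  have h := EuclideanGeometry.dist_inversion_center (0 : Plane) y 1
  simpa [planeInv] using h

lemma planeInv_planeInv (y : Plane) : planeInv (planeInv y) = y :=
  EuclideanGeometry.inversion_inversion 0 one_ne_zero y

lemma injective_planeInv : Function.Injective planeInv :=
  EuclideanGeometry.inversion_injective 0 one_ne_zero

lemma measurable_planeInv : Measurable planeInv := by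
  have : planeInv = fun y : Plane => (1 / ‖y‖) ^ 2 • y := by
    funext y
    simp [planeInv, EuclideanGeometry.inversion]
  rw [this]
  fun_prop

def planeInvDeriv (y : Plane) : Plane →L[ℝ] Plane :=
  (1 / ‖y‖) ^ 2 • ((ℝ ∙ y)ᗮ.reflection : Plane →L[ℝ] Plane)

lemma hasFDerivAt_planeInv {y : Plane} (hy : y ≠ 0) :
    HasFDerivAt planeInv (planeInvDeriv y) y := by
  have h := EuclideanGeometry.hasFDerivAt_inversion (R := 1) hy
  rw [dist_zero_right, sub_zero] at h
  exact h

lemma abs_det_planeInvDeriv (y : Plane) : |(planeInvDeriv y).det| = (1 / ‖y‖) ^ 4 := by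
  have h : (planeInvDeriv y).det = ((1 / ‖y‖) ^ 2) ^ 2 *
      LinearMap.det (ℝ ∙ y)ᗮ.reflection.toLinearMap := by
    have h2 := LinearMap.det_smul ((1 / ‖y‖) ^ 2) (ℝ ∙ y)ᗮ.reflection.toLinearMap
    rw [finrank_euclideanSpace_fin] at h2
    exact h2
  rw [h, Submodule.det_reflection, abs_mul, abs_neg_one_pow, mul_one,
    abs_of_nonneg (by positivity)]
  ring

lemma norm_planeInvDeriv_le (y : Plane) : ‖planeInvDeriv y‖ ≤ (1 / ‖y‖) ^ 2 := by
  refine ContinuousLinearMap.opNorm_le_bound _ (by positivity) fun z => ?_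
  simp [planeInvDeriv, norm_smul]

lemma lintegral_image_planeInv {s : Set Plane} (hs : MeasurableSet s) (h0 : (0 : Plane) ∉ s)
    (g : Plane → ℝ≥0∞) :
    ∫⁻ x in planeInv '' s, g x = ∫⁻ y in s, ENNReal.ofReal ((1 / ‖y‖) ^ 4) * g (planeInv y) := by
  have h := lintegral_image_eq_lintegral_abs_det_fderiv_mul volume hs
    (fun x hx => (hasFDerivAt_planeInv (ne_of_mem_of_not_mem hx h0)).hasFDerivWithinAt)
    injective_planeInv.injOn g
  simpa only [abs_det_planeInvDeriv] using h

lemma lintegral_fderiv_comp_planeInv_le {u : Plane → ℝ} (hu : Differentiable ℝ u) {s : Set Plane}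
    (hs : MeasurableSet s) :
    ∫⁻ y in s, ‖fderiv ℝ (u ∘ planeInv) y‖ₑ ^ 2 ≤ ∫⁻ x, ‖fderiv ℝ u x‖ₑ ^ 2 := by
  have hs0 : MeasurableSet (s \ {0}) := hs.diff (measurableSet_singleton 0)
  calc ∫⁻ y in s, ‖fderiv ℝ (u ∘ planeInv) y‖ₑ ^ 2
      = ∫⁻ y in s \ {0}, ‖fderiv ℝ (u ∘ planeInv) y‖ₑ ^ 2 := by
        refine (setLIntegral_congr ?_).symm
        exact sdiff_null_ae_eq_self (measure_singleton 0)
    _ ≤ ∫⁻ y in s \ {0}, ENNReal.ofReal ((1 / ‖y‖) ^ 4) * ‖fderiv ℝ u (planeInv y)‖ₑ ^ 2 := by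
        refine setLIntegral_mono' hs0 fun y hy => ?_
        have hc := ((hu _).hasFDerivAt.comp y (hasFDerivAt_planeInv hy.2)).fderiv
        rw [hc, ← ofReal_norm, ← ofReal_norm, ← ENNReal.ofReal_pow (norm_nonneg _),
          ← ENNReal.ofReal_pow (norm_nonneg _), ← ENNReal.ofReal_mul (by positivity)]
        refine ENNReal.ofReal_le_ofReal ?_
        have h1 := (ContinuousLinearMap.opNorm_comp_le (fderiv ℝ u (planeInv y))
          (planeInvDeriv y)).trans
          (mul_le_mul_of_nonneg_left (norm_planeInvDeriv_le y) (norm_nonneg _))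
        calc _ ≤ (‖fderiv ℝ u (planeInv y)‖ * (1 / ‖y‖) ^ 2) ^ 2 :=
              pow_le_pow_left₀ (norm_nonneg _) h1 2
          _ = _ := by ring
    _ = ∫⁻ x in planeInv '' (s \ {0}), ‖fderiv ℝ u x‖ₑ ^ 2 :=
        (lintegral_image_planeInv hs0 (by simp) fun x => ‖fderiv ℝ u x‖ₑ ^ 2).symm
    _ ≤ _ := setLIntegral_le_lintegral _ _

lemma lintegral_exterior_le {κ : ℝ} (hκ : 4 < κ) (g : Plane → ℝ≥0∞) :
    ∫⁻ x in {x : Plane | 1 ≤ ‖x‖}, ENNReal.ofReal (‖x‖ ^ (-κ)) * g x ≤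
      ∫⁻ y in Metric.ball (0 : Plane) 2, g (planeInv y) := by
  set s : Set Plane := Metric.closedBall 0 1 \ {0} with hs
  have hsm : MeasurableSet s := measurableSet_closedBall.diff (measurableSet_singleton 0)
  have himg : {x : Plane | 1 ≤ ‖x‖} ⊆ planeInv '' s := by
    intro x hx
    have hx' : 1 ≤ ‖x‖ := hx
    refine ⟨planeInv x, ⟨?_, ?_⟩, planeInv_planeInv x⟩
    · rw [mem_closedBall_zero_iff, norm_planeInv]
      exact inv_le_one_of_one_le₀ hx'
    · rw [Set.mem_singleton_iff, ← norm_eq_zero, norm_planeInv]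
      exact inv_ne_zero (by linarith)
  calc _ ≤ ∫⁻ x in planeInv '' s, ENNReal.ofReal (‖x‖ ^ (-κ)) * g x := lintegral_mono_set himg
    _ = ∫⁻ y in s, ENNReal.ofReal ((1 / ‖y‖) ^ 4) *
          (ENNReal.ofReal (‖planeInv y‖ ^ (-κ)) * g (planeInv y)) :=
        lintegral_image_planeInv hsm (by simp [hs]) _
    _ ≤ ∫⁻ y in s, g (planeInv y) := by
        refine setLIntegral_mono' hsm fun y hy => ?_
        have hy1 : ‖y‖ ≤ 1 := by simpa using hy.1
        have hy0 : 0 < ‖y‖ := norm_pos_iff.2 hy.2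
        rw [← mul_assoc, ← ENNReal.ofReal_mul (by positivity)]
        refine mul_le_of_le_one_left zero_le (ENNReal.ofReal_le_one.2 ?_)
        rw [norm_planeInv, Real.inv_rpow hy0.le, Real.rpow_neg hy0.le, inv_inv, one_div, inv_pow,
          inv_mul_le_one₀ (by positivity), ← Real.rpow_natCast]
        exact Real.rpow_le_rpow_of_exponent_ge hy0 hy1 (by norm_num; exact hκ.le)
    _ ≤ _ := by
        refine lintegral_mono_set (Set.sdiff_subset.trans ?_)
        exact Metric.closedBall_subset_ball one_lt_two
/-- The bound in the subcritical Trudinger–Moser inequality, as a function of the exponent `a` and of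
a bound `D` for the Dirichlet norm. -/
def moserBound (α K a D : ℝ) : ℝ :=
  K * Real.exp (K * (a * D) + a ^ 2 * D ^ 2 / (16 * π * α))

lemma exists_const_lintegral_two_centres {α κ : ℝ} (hα : 0 < α) (hα1 : α < 1) (hκ : 4 < κ) :
    ∃ K : ℝ, 0 < K ∧ ∀ (u : Plane → ℝ) (D : ℝ), Differentiable ℝ u → 0 < D →
      ∫⁻ x, ‖fderiv ℝ u x‖ₑ ^ 2 ≤ ENNReal.ofReal (D ^ 2) →
      ∃ c₁ c₂ : ℝ, ∀ a : ℝ, 0 ≤ a →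
        ∫⁻ x in Metric.ball (0 : Plane) 2, ENNReal.ofReal (Real.exp (a * |u x - c₁|)) ≤
          ENNReal.ofReal (moserBound α K a D) ∧
        ∫⁻ x in {x : Plane | 1 ≤ ‖x‖}, ENNReal.ofReal (‖x‖ ^ (-κ)) *
          ENNReal.ofReal (Real.exp (a * |u x - c₂|)) ≤ ENNReal.ofReal (moserBound α K a D) := by
  obtain ⟨K, hK, h⟩ := exists_const_lintegral_exp_le hα hα1
  refine ⟨K, hK, fun u D hu hD hE => ?_⟩
  have hum : Measurable u := hu.continuous.measurable
  obtain ⟨c₁, hc₁⟩ := h u D hum (fun y _ => hu y) hD ((setLIntegral_le_lintegral _ _).trans hE)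
  obtain ⟨c₂, hc₂⟩ := h (u ∘ planeInv) D (hum.comp measurable_planeInv)
    (fun y hy => (hu _).comp y (hasFDerivAt_planeInv hy).differentiableAt) hD
    ((lintegral_fderiv_comp_planeInv_le hu measurableSet_ball).trans hE)
  exact ⟨c₁, c₂, fun a ha => ⟨hc₁ a ha, (lintegral_exterior_le hκ _).trans (hc₂ a ha)⟩⟩

lemma moserBound_one_div {α K D : ℝ} (hD : 0 < D) :
    moserBound α K (1 / D) D = moserBound α K 1 1 := by
  have h1 : 1 / D * D = 1 := by field_simp
  have h2 : (1 / D) ^ 2 * D ^ 2 = 1 := by field_simp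
  simp only [moserBound, h1, h2, mul_one, one_pow]

lemma abs_sub_centres_le {α κ K D c₁ c₂ : ℝ} (hK : 0 < K) (hκ : 0 < κ) (hD : 0 < D)
    {u : Plane → ℝ} (hu : Measurable u)
    (h₁ : ∫⁻ x in Metric.ball (0 : Plane) 2, ENNReal.ofReal (Real.exp (1 / D * |u x - c₁|)) ≤
      ENNReal.ofReal (moserBound α K 1 1))
    (h₂ : ∫⁻ x in {x : Plane | 1 ≤ ‖x‖}, ENNReal.ofReal (‖x‖ ^ (-κ)) *
      ENNReal.ofReal (Real.exp (1 / D * |u x - c₂|)) ≤ ENNReal.ofReal (moserBound α K 1 1)) :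
    |c₁ - c₂| ≤ 4 / π * (1 + 2 ^ κ) * moserBound α K 1 1 * D := by
  have hE0 : 0 < moserBound α K 1 1 := by unfold moserBound; positivity
  set E := moserBound α K 1 1
  set x₀ : Plane := (3 / 2 : ℝ) • unitVec 0
  have hx₀ : ‖x₀‖ = 3 / 2 := by
    rw [norm_smul, norm_unitVec, mul_one, Real.norm_of_nonneg (by norm_num)]
  set A := Metric.ball x₀ (1 / 2)
  have hA : ∀ x ∈ A, 1 ≤ ‖x‖ ∧ ‖x‖ < 2 := by
    intro x hx
    have hx' : ‖x - x₀‖ < 1 / 2 := by simpa [A, dist_eq_norm] using hx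
    have h := abs_lt.1 ((abs_norm_sub_norm_le x x₀).trans_lt hx')
    constructor <;> linarith [h.1, h.2]
  have hb₁ : ∫⁻ x in A, ENNReal.ofReal (Real.exp (1 / D * |u x - c₁|)) ≤ ENNReal.ofReal E :=
    (lintegral_mono_set fun x hx => by simpa using (hA x hx).2).trans h₁
  have hb₂ : ∫⁻ x in A, ENNReal.ofReal (Real.exp (1 / D * |u x - c₂|)) ≤
      ENNReal.ofReal (2 ^ κ * E) := by
    calc _ ≤ ∫⁻ x in A, ENNReal.ofReal (2 ^ κ) * (ENNReal.ofReal (‖x‖ ^ (-κ)) *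
          ENNReal.ofReal (Real.exp (1 / D * |u x - c₂|))) := by
          refine setLIntegral_mono' measurableSet_ball fun x hx => ?_
          obtain ⟨hx1, hx2⟩ := hA x hx
          have hpos : 0 < ‖x‖ := by linarith
          rw [← mul_assoc, ← ENNReal.ofReal_mul (by positivity)]
          refine le_mul_of_one_le_left zero_le (ENNReal.one_le_ofReal.2 ?_)
          rw [Real.rpow_neg hpos.le, ← div_eq_mul_inv, one_le_div (by positivity)]
          exact Real.rpow_le_rpow hpos.le hx2.le hκ.le
      _ = ENNReal.ofReal (2 ^ κ) * ∫⁻ x in A, ENNReal.ofReal (‖x‖ ^ (-κ)) *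
          ENNReal.ofReal (Real.exp (1 / D * |u x - c₂|)) :=
          lintegral_const_mul' _ _ ENNReal.ofReal_ne_top
      _ ≤ _ := by
          rw [ENNReal.ofReal_mul (by positivity)]
          gcongr
          exact (lintegral_mono_set fun x hx => (hA x hx).1).trans h₂
  have hmain : ENNReal.ofReal (1 / D * |c₁ - c₂| * (π * (1 / 2) ^ 2)) ≤
      ENNReal.ofReal (E + 2 ^ κ * E) := by
    calc _ = ∫⁻ x in A, ENNReal.ofReal (1 / D * |c₁ - c₂|) := by
          rw [setLIntegral_const, volume_ball_plane x₀ (by norm_num),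
            ENNReal.ofReal_mul (by positivity)]
      _ ≤ ∫⁻ x in A, (ENNReal.ofReal (Real.exp (1 / D * |u x - c₁|)) +
          ENNReal.ofReal (Real.exp (1 / D * |u x - c₂|))) := by
          refine lintegral_mono fun x => ?_
          rw [← ENNReal.ofReal_add (Real.exp_pos _).le (Real.exp_pos _).le]
          refine ENNReal.ofReal_le_ofReal ?_
          have h1 := Real.add_one_le_exp (1 / D * |u x - c₁|)
          have h2 := Real.add_one_le_exp (1 / D * |u x - c₂|)
          have h3 : |c₁ - c₂| ≤ |u x - c₁| + |u x - c₂| := by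
            rw [abs_sub_comm (u x) c₁]
            exact abs_sub_le c₁ (u x) c₂
          have h4 := mul_le_mul_of_nonneg_left h3 (one_div_pos.2 hD).le
          linarith
      _ = (∫⁻ x in A, ENNReal.ofReal (Real.exp (1 / D * |u x - c₁|))) +
          ∫⁻ x in A, ENNReal.ofReal (Real.exp (1 / D * |u x - c₂|)) :=
          lintegral_add_left (by fun_prop) _
      _ ≤ ENNReal.ofReal E + ENNReal.ofReal (2 ^ κ * E) := add_le_add hb₁ hb₂
      _ = _ := (ENNReal.ofReal_add hE0.le (by positivity)).symm
  rw [ENNReal.ofReal_le_ofReal_iff (by positivity)] at hmain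
  have hfac : |c₁ - c₂| = 4 / π * D * (1 / D * |c₁ - c₂| * (π * (1 / 2) ^ 2)) := by
    have := pi_pos
    field_simp
    norm_num
  rw [hfac]
  calc _ ≤ 4 / π * D * (E + 2 ^ κ * E) := by gcongr
    _ = _ := by ring

lemma lintegral_wMeasure_le {κ H : ℝ} {h₀ : Plane → ℝ} (hcont : Continuous h₀)
    (h₀eq : ∀ x : Plane, 1 ≤ ‖x‖ → h₀ x = ‖x‖ ^ (-κ)) (hH : ∀ x : Plane, ‖x‖ ≤ 1 → h₀ x ≤ H)
    {g : Plane → ℝ≥0∞} (hg : Measurable g) :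
    ∫⁻ x, g x ∂(wMeasure h₀) ≤ ENNReal.ofReal H * (∫⁻ x in Metric.ball (0 : Plane) 2, g x) +
      ∫⁻ x in {x : Plane | 1 ≤ ‖x‖}, ENNReal.ofReal (‖x‖ ^ (-κ)) * g x := by
  have hm : MeasurableSet {x : Plane | 1 ≤ ‖x‖} := measurableSet_le measurable_const measurable_norm
  rw [wMeasure, lintegral_withDensity_eq_lintegral_mul _ hcont.measurable.ennreal_ofReal hg,
    ← lintegral_add_compl _ hm, add_comm]
  refine add_le_add ?_ (setLIntegral_mono' hm fun x hx => ?_)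
  · rw [← lintegral_const_mul' _ _ ENNReal.ofReal_ne_top]
    calc _ ≤ ∫⁻ x in {x : Plane | 1 ≤ ‖x‖}ᶜ, ENNReal.ofReal H * g x := by
          refine setLIntegral_mono' hm.compl fun x hx => ?_
          have hx' : ‖x‖ < 1 := not_le.1 hx
          exact mul_le_mul_left (ENNReal.ofReal_le_ofReal (hH x hx'.le)) _
      _ ≤ _ := by
          refine lintegral_mono_set fun x hx => ?_
          have hx' : ‖x‖ < 1 := not_le.1 hx
          rw [mem_ball_zero_iff]
          linarith
  · rw [Pi.mul_apply, h₀eq x hx]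

/-- Subcritical Trudinger–Moser inequality for `wMeasure h₀`, relative to a suitable constant. -/
lemma exists_const_lintegral_wMeasure_exp_le {α κ : ℝ} (hα : 0 < α) (hα1 : α < 1) (hκ : 4 < κ)
    {h₀ : Plane → ℝ} (hcont : Continuous h₀)
    (h₀eq : ∀ x : Plane, 1 ≤ ‖x‖ → h₀ x = ‖x‖ ^ (-κ)) :
    ∃ K : ℝ, 0 < K ∧ ∀ (u : Plane → ℝ) (D : ℝ), Differentiable ℝ u → 0 < D →
      ∫⁻ x, ‖fderiv ℝ u x‖ₑ ^ 2 ≤ ENNReal.ofReal (D ^ 2) →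
      ∃ c : ℝ, ∀ a : ℝ, 0 ≤ a →
        ∫⁻ x, ENNReal.ofReal (Real.exp (a * |u x - c|)) ∂(wMeasure h₀) ≤
          ENNReal.ofReal (moserBound α K a D) := by
  obtain ⟨K, hK, hmain⟩ := exists_const_lintegral_two_centres hα hα1 hκ
  obtain ⟨H₀, hH₀⟩ := (isCompact_closedBall (0 : Plane) 1).bddAbove_image hcont.continuousOn
  set H := max H₀ 0
  have hH0 : 0 ≤ H := le_max_right _ _
  have hH : ∀ x : Plane, ‖x‖ ≤ 1 → h₀ x ≤ H := fun x hx =>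
    (hH₀ ⟨x, mem_closedBall_zero_iff.2 hx, rfl⟩).trans (le_max_left _ _)
  set K₂ := 4 / π * (1 + 2 ^ κ) * moserBound α K 1 1
  have hK₂0 : 0 ≤ K₂ := by unfold K₂ moserBound; positivity
  refine ⟨(H + 1) * K + K + K₂, by positivity, fun u D hu hD hE => ?_⟩
  have hum : Measurable u := hu.continuous.measurable
  obtain ⟨c₁, c₂, hc⟩ := hmain u D hu hD hE
  have hclose : |c₁ - c₂| ≤ K₂ * D := by
    obtain ⟨h₁, h₂⟩ := hc (1 / D) (one_div_pos.2 hD).le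
    rw [moserBound_one_div hD] at h₁ h₂
    exact abs_sub_centres_le hK (by linarith) hD hum h₁ h₂
  refine ⟨c₁, fun a ha => ?_⟩
  obtain ⟨h₁, h₂⟩ := hc a ha
  have haD : 0 ≤ a * D := by positivity
  have hB0 : 0 < moserBound α K a D := by unfold moserBound; positivity
  have hext : ∫⁻ x in {x : Plane | 1 ≤ ‖x‖}, ENNReal.ofReal (‖x‖ ^ (-κ)) *
      ENNReal.ofReal (Real.exp (a * |u x - c₁|)) ≤
      ENNReal.ofReal (Real.exp (K₂ * (a * D)) * moserBound α K a D) := by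
    rw [ENNReal.ofReal_mul (Real.exp_pos _).le]
    refine le_trans ?_ (mul_le_mul_right h₂ _)
    rw [← lintegral_const_mul' _ _ ENNReal.ofReal_ne_top]
    refine lintegral_mono fun x => ?_
    rw [mul_left_comm]
    refine mul_le_mul_right ?_ _
    rw [← ENNReal.ofReal_mul (Real.exp_pos _).le, ← Real.exp_add]
    refine ENNReal.ofReal_le_ofReal (Real.exp_le_exp.2 ?_)
    have h3 : |u x - c₁| ≤ |u x - c₂| + K₂ * D := by
      rw [abs_sub_comm] at hclose
      exact (abs_sub_le (u x) c₂ c₁).trans (by linarith)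
    have := mul_le_mul_of_nonneg_left h3 ha
    linarith
  calc _ ≤ ENNReal.ofReal H * ENNReal.ofReal (moserBound α K a D) +
        ENNReal.ofReal (Real.exp (K₂ * (a * D)) * moserBound α K a D) := by
        refine (lintegral_wMeasure_le hcont h₀eq hH (by fun_prop)).trans ?_
        gcongr
    _ = ENNReal.ofReal ((H + Real.exp (K₂ * (a * D))) * moserBound α K a D) := by
        rw [← ENNReal.ofReal_mul hH0, ← ENNReal.ofReal_add (by positivity) (by positivity), add_mul]
    _ ≤ _ := by
        refine ENNReal.ofReal_le_ofReal ?_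
        have hexp : 1 ≤ Real.exp (K₂ * (a * D)) := Real.one_le_exp (by positivity)
        calc (H + Real.exp (K₂ * (a * D))) * moserBound α K a D
            ≤ ((H + 1) * Real.exp (K₂ * (a * D))) * moserBound α K a D := by
              gcongr
              nlinarith
          _ = ((H + 1) * K) * Real.exp (K₂ * (a * D) + (K * (a * D) +
                a ^ 2 * D ^ 2 / (16 * π * α))) := by
              rw [moserBound, Real.exp_add (K₂ * (a * D))]
              ring
          _ ≤ _ := by
              unfold moserBound
              refine mul_le_mul (by linarith) (Real.exp_le_exp.2 ?_) (Real.exp_pos _).le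
                (by positivity)
              have : 0 ≤ (H + 1) * K * (a * D) := by positivity
              linarith

/-- Subcritical Trudinger–Moser inequality for functions of mean zero with respect to
`wMeasure h₀`. -/
lemma exists_const_lintegral_wMeasure_exp_le_of_integral_eq_zero {α κ : ℝ} (hα : 0 < α)
    (hα1 : α < 1) (hκ : 4 < κ) {h₀ : Plane → ℝ} (hcont : Continuous h₀) (h₀pos : ∀ x, 0 < h₀ x)
    (h₀eq : ∀ x : Plane, 1 ≤ ‖x‖ → h₀ x = ‖x‖ ^ (-κ)) :
    ∃ K : ℝ, 0 < K ∧ ∀ (u : Plane → ℝ) (D : ℝ), Differentiable ℝ u → 0 < D →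
      ∫⁻ x, ‖fderiv ℝ u x‖ₑ ^ 2 ≤ ENNReal.ofReal (D ^ 2) → ∫ x, u x ∂(wMeasure h₀) = 0 →
      ∀ a : ℝ, 0 ≤ a → ∫⁻ x, ENNReal.ofReal (Real.exp (a * |u x|)) ∂(wMeasure h₀) ≤
        ENNReal.ofReal (moserBound α K a D) := by
  obtain ⟨K, hK, hmain⟩ := exists_const_lintegral_wMeasure_exp_le hα hα1 hκ hcont h₀eq
  set μ := wMeasure h₀
  have hfin : IsFiniteMeasure μ := by
    obtain ⟨c, hc⟩ := hmain (fun _ => 0) 1 (differentiable_const 0) one_pos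
      (by simp [← ofReal_norm])
    have h := hc 0 le_rfl
    simp only [zero_mul, Real.exp_zero, ENNReal.ofReal_one, lintegral_one] at h
    exact ⟨h.trans_lt ENNReal.ofReal_lt_top⟩
  have hμ0 : μ Set.univ ≠ 0 := by
    intro h
    have hac : (volume : Measure Plane) ≪ μ :=
      withDensity_absolutelyContinuous' hcont.measurable.ennreal_ofReal.aemeasurable
        (Eventually.of_forall fun x => (ENNReal.ofReal_pos.2 (h₀pos x)).ne')
    exact (NeZero.ne (volume : Measure Plane)) (Measure.measure_univ_eq_zero.1 (hac h))
  have hm : 0 < μ.real Set.univ := ENNReal.toReal_pos hμ0 (measure_ne_top _ _)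
  set m := μ.real Set.univ
  have hE0 : 0 < moserBound α K 1 1 := by unfold moserBound; positivity
  set K₃ := moserBound α K 1 1 / m
  have hK₃0 : 0 < K₃ := by positivity
  refine ⟨K + K₃, by positivity, fun u D hu hD hE hmean a ha => ?_⟩
  obtain ⟨c, hc⟩ := hmain u D hu hD hE
  have hL1 : ∫⁻ x, ‖u x - c‖ₑ ∂μ ≤ ENNReal.ofReal (D * moserBound α K 1 1) := by
    rw [ENNReal.ofReal_mul hD.le, ← moserBound_one_div hD]
    refine le_trans ?_ (mul_le_mul_right (hc (1 / D) (one_div_pos.2 hD).le) _)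
    rw [← lintegral_const_mul' _ _ ENNReal.ofReal_ne_top]
    refine lintegral_mono fun x => ?_
    rw [← ofReal_norm, Real.norm_eq_abs, ← ENNReal.ofReal_mul hD.le]
    refine ENNReal.ofReal_le_ofReal ?_
    have h1 := Real.add_one_le_exp (1 / D * |u x - c|)
    calc |u x - c| = D * (1 / D * |u x - c|) := by field_simp
      _ ≤ _ := by gcongr; linarith
  have hInt : Integrable (fun x => u x - c) μ :=
    ⟨(hu.continuous.sub continuous_const).aestronglyMeasurable,
      hL1.trans_lt ENNReal.ofReal_lt_top⟩
  have hcD : |c| ≤ K₃ * D := by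
    have hintu : Integrable u μ := by
      simpa [Pi.add_def] using hInt.add (integrable_const c)
    have h1 : ∫ x, (u x - c) ∂μ = -(m * c) := by
      rw [integral_sub hintu (integrable_const c), hmean, integral_const, zero_sub, smul_eq_mul]
    have h2 : ‖∫ x, (u x - c) ∂μ‖ₑ ≤ ENNReal.ofReal (D * moserBound α K 1 1) :=
      (enorm_integral_le_lintegral_enorm _).trans hL1
    rw [h1, enorm_neg, ← ofReal_norm, norm_mul, Real.norm_of_nonneg hm.le, Real.norm_eq_abs,
      ENNReal.ofReal_le_ofReal_iff (by positivity)] at h2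
    rw [div_mul_eq_mul_div, le_div_iff₀ hm]
    linarith
  calc _ ≤ ∫⁻ x, ENNReal.ofReal (Real.exp (K₃ * (a * D))) *
        ENNReal.ofReal (Real.exp (a * |u x - c|)) ∂μ := by
        refine lintegral_mono fun x => ?_
        rw [← ENNReal.ofReal_mul (Real.exp_pos _).le, ← Real.exp_add]
        refine ENNReal.ofReal_le_ofReal (Real.exp_le_exp.2 ?_)
        have h3 : |u x| ≤ |u x - c| + K₃ * D := by
          have := abs_add_le (u x - c) c
          rw [sub_add_cancel] at this
          linarith
        have := mul_le_mul_of_nonneg_left h3 ha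
        linarith
    _ ≤ ENNReal.ofReal (Real.exp (K₃ * (a * D))) * ENNReal.ofReal (moserBound α K a D) := by
        rw [lintegral_const_mul' _ _ ENNReal.ofReal_ne_top]
        gcongr
        exact hc a ha
    _ = ENNReal.ofReal (K * Real.exp ((K + K₃) * (a * D) + a ^ 2 * D ^ 2 / (16 * π * α))) := by
        rw [← ENNReal.ofReal_mul (Real.exp_pos _).le, moserBound, mul_left_comm, ← Real.exp_add]
        congr 3
        ring
    _ ≤ _ := by
        unfold moserBound
        gcongr
        linarith

lemma lintegral_enorm_fderiv_sq {u : Plane → ℝ}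
    (hu : Integrable (fun x => ‖gradient u x‖ ^ 2) volume) :
    ∫⁻ x, ‖fderiv ℝ u x‖ₑ ^ 2 = ENNReal.ofReal (∫ x, ‖gradient u x‖ ^ 2) := by
  rw [ofReal_integral_eq_lintegral_ofReal hu (Eventually.of_forall fun x => by positivity)]
  refine lintegral_congr fun x => ?_
  rw [ENNReal.ofReal_pow (norm_nonneg _), gradient, LinearIsometryEquiv.norm_map, ofReal_norm]

lemma moserBound_le {K a D I ε : ℝ} (hε : 0 < ε) (hε4 : ε < 4 * π)
    (hK : 0 < K) (hI : a ^ 2 * D ^ 2 ≤ a ^ 2 * I + 1) :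
    moserBound ((4 * π - ε / 2) / (4 * π)) K a D ≤
      K * Real.exp (K ^ 2 / (4 * (1 / (4 * (4 * π - ε)) - 1 / (4 * (4 * π - ε / 2)))) +
        1 / (4 * (4 * π - ε))) * Real.exp (a ^ 2 / (4 * (4 * π - ε)) * I) := by
  have h1 : 0 < 4 * (4 * π - ε) := by linarith
  have hη : 0 < 1 / (4 * (4 * π - ε)) - 1 / (4 * (4 * π - ε / 2)) :=
    sub_pos.2 (one_div_lt_one_div_of_lt h1 (by linarith))
  have hα : 16 * π * ((4 * π - ε / 2) / (4 * π)) = 4 * (4 * π - ε / 2) := by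
    have := pi_pos
    field_simp
    ring
  rw [moserBound, hα, mul_assoc, ← Real.exp_add]
  refine mul_le_mul_of_nonneg_left (Real.exp_le_exp.2 ?_) hK.le
  have hs : 0 < 1 / (4 * (4 * π - ε)) := one_div_pos.2 h1
  rw [div_eq_mul_one_div (a ^ 2 * D ^ 2), div_eq_mul_one_div (a ^ 2) (4 * (4 * π - ε))]
  generalize hsd : 1 / (4 * (4 * π - ε)) = s at *
  generalize 1 / (4 * (4 * π - ε / 2)) = s' at *
  have hamgm : K * (a * D) ≤ (s - s') * (a * D) ^ 2 + K ^ 2 / (4 * (s - s')) := by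
    have h := sq_nonneg (2 * (s - s') * (a * D) - K)
    rw [← sub_nonneg]
    calc 0 ≤ (2 * (s - s') * (a * D) - K) ^ 2 / (4 * (s - s')) := by positivity
      _ = _ := by
        field_simp
        ring
  have := mul_le_mul_of_nonneg_left hI hs.le
  nlinarith

/-- Weighted Trudinger–Moser inequality on 𝓗̃. -/
theorem weighted_trudinger_moser
    (κ : ℝ) (hκ : 4 < κ) (h₀ : Plane → ℝ)
    (h₀smooth : ContDiff ℝ (⊤ : ℕ∞) h₀) (h₀pos : ∀ x, 0 < h₀ x)
    (h₀eq : ∀ x : Plane, 1 ≤ ‖x‖ → h₀ x = ‖x‖ ^ (-κ)) :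
    ∀ ε : ℝ, 0 < ε → ε < 4 * π →
      ∃ C : ℝ, 0 < C ∧ ∀ (a : ℝ) (u : Plane → ℝ), MemHt h₀ u →
        (∫⁻ x, ENNReal.ofReal (Real.exp (a * |u x|)) ∂(wMeasure h₀)) ≤
          ENNReal.ofReal
            (C * Real.exp (a ^ 2 / (4 * (4 * π - ε)) * ∫ x, ‖gradient u x‖ ^ 2)) := by
  intro ε hε hε4
  have hα : 0 < (4 * π - ε / 2) / (4 * π) := div_pos (by linarith) (by positivity)
  have hα1 : (4 * π - ε / 2) / (4 * π) < 1 := (div_lt_one (by positivity)).2 (by linarith)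
  obtain ⟨K, hK, hmain⟩ := exists_const_lintegral_wMeasure_exp_le_of_integral_eq_zero hα hα1 hκ
    h₀smooth.continuous h₀pos h₀eq
  refine ⟨K * Real.exp (K ^ 2 / (4 * (1 / (4 * (4 * π - ε)) - 1 / (4 * (4 * π - ε / 2)))) +
    1 / (4 * (4 * π - ε))), by positivity, ?_⟩
  rintro a u ⟨⟨hu, hgrad, -⟩, hmean⟩
  set I := ∫ x, ‖gradient u x‖ ^ 2
  have hI0 : 0 ≤ I := integral_nonneg fun x => by positivity
  have hD2 : 0 < I + 1 / (1 + |a| ^ 2) := by positivity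
  have hsq : Real.sqrt (I + 1 / (1 + |a| ^ 2)) ^ 2 = I + 1 / (1 + |a| ^ 2) := Real.sq_sqrt hD2.le
  have hE : ∫⁻ x, ‖fderiv ℝ u x‖ₑ ^ 2 ≤
      ENNReal.ofReal (Real.sqrt (I + 1 / (1 + |a| ^ 2)) ^ 2) := by
    rw [lintegral_enorm_fderiv_sq hgrad, hsq]
    exact ENNReal.ofReal_le_ofReal (le_add_of_nonneg_right (by positivity))
  refine (lintegral_mono fun x => ENNReal.ofReal_le_ofReal (Real.exp_le_exp.2
    (mul_le_mul_of_nonneg_right (le_abs_self a) (abs_nonneg (u x))))).trans ?_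
  refine (hmain u _ hu (Real.sqrt_pos.2 hD2) hE hmean |a| (abs_nonneg a)).trans ?_
  refine ENNReal.ofReal_le_ofReal ?_
  rw [← sq_abs a]
  refine moserBound_le hε hε4 hK ?_
  rw [hsq, mul_add]
  gcongr
  rw [mul_one_div]
  exact (div_le_one (by positivity)).2 (by linarith)
end
end

section
/- Weighted Poincaré inequality: there exists a constant C > 0 such that ‖u‖²_{L²(ℝ²,dμ)} ≤ C · ‖∇u‖²_{L²(ℝ²,dx)} for every u ∈ 𝓗̃. -/
noncomputable section

open MeasureTheory Real Filter Topology
open scoped ENNReal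

lemma measurable_gradient_plane (u : Plane → ℝ) : Measurable (gradient u) :=
  (InnerProductSpace.toDual ℝ Plane).symm.continuous.measurable.comp (measurable_fderiv ℝ u)

lemma sub_sq_le_lintegral_deriv_sq {f : ℝ → ℝ} (hf : Differentiable ℝ f) :
    ENNReal.ofReal ((f 1 - f 0) ^ 2) ≤
      ∫⁻ t in Set.Ioc (0 : ℝ) 1, ENNReal.ofReal (deriv f t ^ 2) := by
  by_cases htop : ∫⁻ t in Set.Ioc (0 : ℝ) 1, ENNReal.ofReal (deriv f t ^ 2) = ⊤
  · rw [htop]; exact le_top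
  set P : Measure ℝ := volume.restrict (Set.Ioc (0 : ℝ) 1) with hP
  have : IsProbabilityMeasure P := ⟨by simp [hP]⟩
  have hm : Measurable (deriv f) := measurable_deriv f
  have hsq : Integrable (fun t => deriv f t ^ 2) P := by
    refine ⟨(hm.pow_const 2).aestronglyMeasurable, ?_⟩
    rw [hasFiniteIntegral_iff_ofReal (Eventually.of_forall fun t => sq_nonneg _)]
    exact lt_top_iff_ne_top.2 htop
  have hL2 : MemLp (deriv f) 2 P :=
    (memLp_two_iff_integrable_sq hm.aestronglyMeasurable).2 hsq
  have hint : Integrable (deriv f) P := hL2.integrable (by norm_num)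
  have hftc : ∫ t, deriv f t ∂P = f 1 - f 0 := by
    rw [hP, ← intervalIntegral.integral_of_le zero_le_one]
    refine intervalIntegral.integral_eq_sub_of_hasDerivAt (fun t _ => (hf t).hasDerivAt) ?_
    rw [intervalIntegrable_iff_integrableOn_Ioc_of_le zero_le_one]
    exact hint
  have hvar := ProbabilityTheory.variance_nonneg (deriv f) P
  rw [ProbabilityTheory.variance_eq_sub hL2, hftc] at hvar
  rw [← ofReal_integral_eq_lintegral_ofReal hsq (Eventually.of_forall fun t => sq_nonneg _)]
  refine ENNReal.ofReal_le_ofReal ?_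
  have : ∫ t, (deriv f ^ 2) t ∂P = ∫ t, deriv f t ^ 2 ∂P := rfl
  linarith

lemma sub_sq_le_lintegral_segment {u : Plane → ℝ} (hu : Differentiable ℝ u) (x y : Plane) :
    ENNReal.ofReal ((u x - u y) ^ 2) ≤ ENNReal.ofReal (‖x - y‖ ^ 2) *
      ∫⁻ t in Set.Ioc (0 : ℝ) 1,
        ENNReal.ofReal (‖gradient u ((1 - t) • x + t • y)‖ ^ 2) := by
  have hγ (t : ℝ) : HasDerivAt (fun t : ℝ => (1 - t) • x + t • y) (y - x) t := by
    have h1 : HasDerivAt (fun t : ℝ => (1 - t) • x) ((-1 : ℝ) • x) t :=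
      ((hasDerivAt_id t).const_sub 1).smul_const x
    have h2 : HasDerivAt (fun t : ℝ => t • y) ((1 : ℝ) • y) t :=
      (hasDerivAt_id t).smul_const y
    have h3 : (-1 : ℝ) • x + (1 : ℝ) • y = y - x := by module
    exact h3 ▸ h1.add h2
  have hf (t : ℝ) : HasDerivAt (fun t : ℝ => u ((1 - t) • x + t • y))
      (fderiv ℝ u ((1 - t) • x + t • y) (y - x)) t :=
    (hu _).hasFDerivAt.comp_hasDerivAt t (hγ t)
  have key := sub_sq_le_lintegral_deriv_sq (fun t => (hf t).differentiableAt)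
  simp only [sub_self, zero_smul, one_smul, zero_add, sub_zero, add_zero] at key
  rw [show (u x - u y) ^ 2 = (u y - u x) ^ 2 by ring]
  refine key.trans ?_
  rw [← lintegral_const_mul' _ _ ENNReal.ofReal_ne_top]
  refine lintegral_mono fun t => ?_
  dsimp only
  rw [← ENNReal.ofReal_mul (by positivity), (hf t).deriv, ← inner_gradient_left]
  refine ENNReal.ofReal_le_ofReal ?_
  rw [← mul_pow, ← sq_abs, mul_comm, norm_sub_rev x y]
  exact pow_le_pow_left₀ (abs_nonneg _) (abs_real_inner_le_norm _ _) 2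

lemma lintegral_comp_smul_add_le {G : Plane → ℝ≥0∞} (hG : Measurable G) {a : ℝ}
    (ha : 1 / 2 ≤ a) (b : Plane) : ∫⁻ x, G (a • x + b) ≤ 4 * ∫⁻ x, G x := by
  have ha0 : a ≠ 0 := by linarith
  have h1 : ∫⁻ x, G (a • x + b) = ∫⁻ z, G (z + b) ∂(Measure.map (a • ·) volume) :=
    (lintegral_map (hG.comp (measurable_id.add_const b)) (measurable_const_smul a)).symm
  rw [h1, Measure.map_addHaar_smul volume ha0, lintegral_smul_measure,
    lintegral_add_right_eq_self G b, smul_eq_mul]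
  gcongr
  rw [← ENNReal.ofReal_ofNat 4]
  refine ENNReal.ofReal_le_ofReal ?_
  rw [finrank_euclideanSpace, Fintype.card_fin, abs_of_nonneg (by positivity)]
  refine inv_le_of_inv_le₀ (by norm_num) ?_
  nlinarith

lemma lintegral_segment_le {G w : Plane → ℝ≥0∞} (hG : Measurable G) (hw : Measurable w)
    {B : ℝ≥0∞} (hB : ∀ x, w x ≤ B) (t : ℝ) :
    ∫⁻ x, ∫⁻ y, w x * w y * G ((1 - t) • x + t • y) ≤
      4 * B * (∫⁻ x, w x) * ∫⁻ x, G x := by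
  have half (s : ℝ) (hs : 1 / 2 ≤ s) :
      ∫⁻ x, ∫⁻ y, w x * w y * G (s • y + (1 - s) • x) ≤
        4 * B * (∫⁻ x, w x) * ∫⁻ x, G x := by
    calc ∫⁻ x, ∫⁻ y, w x * w y * G (s • y + (1 - s) • x)
        ≤ ∫⁻ x, w x * (B * (4 * ∫⁻ z, G z)) := by
          refine lintegral_mono fun x => ?_
          calc ∫⁻ y, w x * w y * G (s • y + (1 - s) • x)
              ≤ ∫⁻ y, (w x * B) * G (s • y + (1 - s) • x) := by
                gcongr with y
                exact hB y
            _ = (w x * B) * ∫⁻ y, G (s • y + (1 - s) • x) :=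
                lintegral_const_mul _ (by fun_prop)
            _ ≤ (w x * B) * (4 * ∫⁻ z, G z) := by
                gcongr
                exact lintegral_comp_smul_add_le hG hs _
            _ = w x * (B * (4 * ∫⁻ z, G z)) := by ring
      _ = 4 * B * (∫⁻ x, w x) * ∫⁻ x, G x := by
          rw [lintegral_mul_const _ hw]; ring
  rcases le_total (1 / 2) t with ht | ht
  · simpa only [add_comm] using half t ht
  · rw [lintegral_lintegral_swap (by unfold Function.uncurry; fun_prop)]
    refine (le_of_eq ?_).trans (half (1 - t) (by linarith))
    refine lintegral_congr fun y => lintegral_congr fun x => ?_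
    rw [mul_comm (w x), sub_sub_cancel]

lemma lintegral_sub_sq_le {u h : Plane → ℝ} (hu : Differentiable ℝ u) (hh : Continuous h)
    (h0 : ∀ x, 0 ≤ h x) {B : ℝ≥0∞} (hB : ∀ x, ENNReal.ofReal (h x * (1 + ‖x‖ ^ 2)) ≤ B) :
    ∫⁻ x, ∫⁻ y, ENNReal.ofReal ((u x - u y) ^ 2) ∂(wMeasure h) ∂(wMeasure h) ≤
      2 * (4 * B * ∫⁻ x, ENNReal.ofReal (h x * (1 + ‖x‖ ^ 2))) *
        ∫⁻ x, ENNReal.ofReal (‖gradient u x‖ ^ 2) := by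
  set G : Plane → ℝ≥0∞ := fun x => ENNReal.ofReal (‖gradient u x‖ ^ 2) with hGdef
  set w : Plane → ℝ≥0∞ := fun x => ENNReal.ofReal (h x * (1 + ‖x‖ ^ 2)) with hwdef
  have hG : Measurable G := ((measurable_gradient_plane u).norm.pow_const 2).ennreal_ofReal
  have hw : Measurable w := by fun_prop
  have hρ : Measurable fun x => ENNReal.ofReal (h x) := by fun_prop
  have huc : Continuous u := hu.continuous
  have hpt (x y : Plane) : ENNReal.ofReal (h x) * (ENNReal.ofReal (h y) *
      ENNReal.ofReal ((u x - u y) ^ 2)) ≤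
      ∫⁻ t in Set.Ioc (0 : ℝ) 1, 2 * (w x * w y * G ((1 - t) • x + t • y)) := by
    have hxy : ENNReal.ofReal (h x) * (ENNReal.ofReal (h y) * ENNReal.ofReal (‖x - y‖ ^ 2)) ≤
        2 * (w x * w y) := by
      refine le_of_le_of_eq (b := ENNReal.ofReal 2 * (w x * w y)) ?_
        (by rw [ENNReal.ofReal_ofNat])
      simp only [hwdef]
      rw [← ENNReal.ofReal_mul (h0 y),
        ← ENNReal.ofReal_mul (h0 x),
        ← ENNReal.ofReal_mul (mul_nonneg (h0 x) (by positivity)),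
        ← ENNReal.ofReal_mul (by norm_num)]
      refine ENNReal.ofReal_le_ofReal ?_
      have h1 : ‖x - y‖ ^ 2 ≤ (‖x‖ + ‖y‖) ^ 2 :=
        pow_le_pow_left₀ (norm_nonneg _) (norm_sub_le x y) 2
      have h2 : ‖x - y‖ ^ 2 ≤ 2 * ((1 + ‖x‖ ^ 2) * (1 + ‖y‖ ^ 2)) := by
        nlinarith [sq_nonneg (‖x‖ - ‖y‖), sq_nonneg (‖x‖ * ‖y‖)]
      calc h x * (h y * ‖x - y‖ ^ 2) = (h x * h y) * ‖x - y‖ ^ 2 := by ring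
        _ ≤ (h x * h y) * (2 * ((1 + ‖x‖ ^ 2) * (1 + ‖y‖ ^ 2))) :=
          mul_le_mul_of_nonneg_left h2 (mul_nonneg (h0 x) (h0 y))
        _ = _ := by ring
    have hGt : Measurable fun t : ℝ => G ((1 - t) • x + t • y) := by fun_prop
    calc _ ≤ ENNReal.ofReal (h x) * (ENNReal.ofReal (h y) * (ENNReal.ofReal (‖x - y‖ ^ 2) *
          ∫⁻ t in Set.Ioc (0 : ℝ) 1, G ((1 - t) • x + t • y))) := by
          gcongr
          exact sub_sq_le_lintegral_segment hu x y
      _ = ENNReal.ofReal (h x) * (ENNReal.ofReal (h y) * ENNReal.ofReal (‖x - y‖ ^ 2)) *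
          ∫⁻ t in Set.Ioc (0 : ℝ) 1, G ((1 - t) • x + t • y) := by ring
      _ ≤ 2 * (w x * w y) * ∫⁻ t in Set.Ioc (0 : ℝ) 1, G ((1 - t) • x + t • y) := by
          gcongr
      _ = _ := by
          rw [← lintegral_const_mul _ hGt]
          simp only [mul_assoc]
  have hinner (x : Plane) : ∫⁻ y, ENNReal.ofReal ((u x - u y) ^ 2) ∂(wMeasure h) =
      ∫⁻ y, ENNReal.ofReal (h y) * ENNReal.ofReal ((u x - u y) ^ 2) :=
    lintegral_withDensity_eq_lintegral_mul _ hρ (by fun_prop)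
  simp only [hinner]
  have hout : Measurable fun x =>
      ∫⁻ y, ENNReal.ofReal (h y) * ENNReal.ofReal ((u x - u y) ^ 2) :=
    Measurable.lintegral_prod_right'
      (f := fun p : Plane × Plane => ENNReal.ofReal (h p.2) * ENNReal.ofReal ((u p.1 - u p.2) ^ 2))
      (by fun_prop)
  have h1 := lintegral_withDensity_eq_lintegral_mul volume hρ hout
  refine (h1.le.trans ?_)
  have hmeas : Measurable fun p : (Plane × Plane) × ℝ =>
      2 * (w p.1.1 * w p.1.2 * G ((1 - p.2) • p.1.1 + p.2 • p.1.2)) := by fun_prop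
  calc _ ≤ ∫⁻ x, ∫⁻ y, ∫⁻ t in Set.Ioc (0 : ℝ) 1,
          2 * (w x * w y * G ((1 - t) • x + t • y)) := by
        refine lintegral_mono fun x => ?_
        simp only [Pi.mul_apply]
        rw [← lintegral_const_mul _ (by fun_prop)]
        exact lintegral_mono fun y => hpt x y
    _ = ∫⁻ p : Plane × Plane, ∫⁻ t in Set.Ioc (0 : ℝ) 1,
          2 * (w p.1 * w p.2 * G ((1 - t) • p.1 + t • p.2)) := by
        rw [Measure.volume_eq_prod]
        exact (lintegral_prod _ hmeas.lintegral_prod_right'.aemeasurable).symm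
    _ = ∫⁻ t in Set.Ioc (0 : ℝ) 1, ∫⁻ p : Plane × Plane,
          2 * (w p.1 * w p.2 * G ((1 - t) • p.1 + t • p.2)) :=
        lintegral_lintegral_swap hmeas.aemeasurable
    _ ≤ ∫⁻ _ in Set.Ioc (0 : ℝ) 1, 2 * (4 * B * (∫⁻ x, w x) * ∫⁻ x, G x) := by
        refine lintegral_mono fun t => ?_
        dsimp only
        rw [lintegral_const_mul _ (by fun_prop), Measure.volume_eq_prod,
          lintegral_prod _ (Measurable.aemeasurable (by fun_prop))]
        gcongr
        exact lintegral_segment_le hG hw hB t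
    _ = _ := by simp; ring

lemma exists_weight_le {κ : ℝ} (hκ : 2 ≤ κ) {h : Plane → ℝ} (hh : Continuous h)
    (heq : ∀ x : Plane, 1 ≤ ‖x‖ → h x = ‖x‖ ^ (-κ)) :
    ∃ D : ℝ, 0 < D ∧ ∀ x, h x * (1 + ‖x‖ ^ 2) ≤ D * (1 + ‖x‖) ^ (-(κ - 2)) := by
  have hcont : Continuous fun x : Plane => h x * (1 + ‖x‖ ^ 2) * (1 + ‖x‖) ^ (κ - 2) :=
    (by fun_prop : Continuous fun x : Plane => h x * (1 + ‖x‖ ^ 2)).mul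
      ((by fun_prop : Continuous fun x : Plane => 1 + ‖x‖).rpow_const
        fun x => Or.inl (by positivity))
  obtain ⟨D₁, hD₁⟩ := (isCompact_closedBall (0 : Plane) 1).bddAbove_image hcont.continuousOn
  refine ⟨max D₁ (2 * 2 ^ (κ - 2)), lt_max_of_lt_right (by positivity), fun x => ?_⟩
  have hpos : 0 < 1 + ‖x‖ := by positivity
  rw [rpow_neg hpos.le, ← div_eq_mul_inv, le_div_iff₀ (rpow_pos_of_pos hpos _)]
  rcases le_total ‖x‖ 1 with hx | hx
  · exact le_max_of_le_left (hD₁ ⟨x, by simpa using hx, rfl⟩)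
  · refine le_max_of_le_right ?_
    have hx0 : 0 < ‖x‖ := by linarith
    have h1 : (1 + ‖x‖) ^ (κ - 2) ≤ (2 * ‖x‖) ^ (κ - 2) :=
      rpow_le_rpow hpos.le (by linarith) (by linarith)
    rw [mul_rpow (by norm_num) hx0.le] at h1
    have h2 : 1 + ‖x‖ ^ 2 ≤ 2 * ‖x‖ ^ 2 := by nlinarith
    have h3 : ‖x‖ ^ (-κ) * (‖x‖ ^ 2 * ‖x‖ ^ (κ - 2)) = 1 := by
      rw [← rpow_natCast ‖x‖ 2, ← rpow_add hx0, ← rpow_add hx0]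
      simp
    rw [heq x hx]
    calc ‖x‖ ^ (-κ) * (1 + ‖x‖ ^ 2) * (1 + ‖x‖) ^ (κ - 2)
        ≤ ‖x‖ ^ (-κ) * (2 * ‖x‖ ^ 2) * (2 ^ (κ - 2) * ‖x‖ ^ (κ - 2)) := by gcongr
      _ = 2 * 2 ^ (κ - 2) * (‖x‖ ^ (-κ) * (‖x‖ ^ 2 * ‖x‖ ^ (κ - 2))) := by ring
      _ = 2 * 2 ^ (κ - 2) := by rw [h3, mul_one]

lemma measure_mul_lintegral_sq_le {α : Type*} [MeasurableSpace α] {μ : Measure α}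
    [IsFiniteMeasure μ] {u : α → ℝ} (hu : Integrable u μ)
    (hsq : Integrable (fun x => u x ^ 2) μ) (hmean : ∫ x, u x ∂μ = 0) :
    μ Set.univ * ∫⁻ x, ENNReal.ofReal (u x ^ 2) ∂μ ≤
      ∫⁻ x, ∫⁻ y, ENNReal.ofReal ((u x - u y) ^ 2) ∂μ ∂μ := by
  rw [← lintegral_const_mul' _ _ (measure_ne_top μ _)]
  refine lintegral_mono fun x => ?_
  have hexp : (fun y => (u x - u y) ^ 2) = fun y => u x ^ 2 - 2 * u x * u y + u y ^ 2 := by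
    ext y; ring
  have hi1 : Integrable (fun y => u x ^ 2 - 2 * u x * u y) μ :=
    (integrable_const _).sub (hu.const_mul _)
  have hint : Integrable (fun y => (u x - u y) ^ 2) μ := hexp ▸ hi1.add hsq
  rw [← ofReal_integral_eq_lintegral_ofReal hint (Eventually.of_forall fun y => sq_nonneg _),
    hexp, integral_add hi1 hsq, integral_sub (integrable_const _) (hu.const_mul _),
    integral_const_mul, hmean, integral_const, ← ofReal_measureReal,
    ← ENNReal.ofReal_mul measureReal_nonneg]
  refine ENNReal.ofReal_le_ofReal ?_
  have : 0 ≤ ∫ y, u y ^ 2 ∂μ := integral_nonneg fun y => sq_nonneg _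
  simp only [smul_eq_mul]
  linarith

/-- Weighted Poincaré inequality on 𝓗̃. -/
theorem weighted_poincare
    (κ : ℝ) (hκ : 4 < κ) (h₀ : Plane → ℝ)
    (h₀smooth : ContDiff ℝ (⊤ : ℕ∞) h₀) (h₀pos : ∀ x, 0 < h₀ x)
    (h₀eq : ∀ x : Plane, 1 ≤ ‖x‖ → h₀ x = ‖x‖ ^ (-κ)) :
    ∃ C : ℝ, 0 < C ∧ ∀ u : Plane → ℝ, MemHt h₀ u →
      ∫ x, u x ^ 2 ∂(wMeasure h₀) ≤ C * ∫ x, ‖gradient u x‖ ^ 2 := by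
  have hcont : Continuous h₀ := h₀smooth.continuous
  have h0 (x : Plane) : 0 ≤ h₀ x := (h₀pos x).le
  obtain ⟨D, hD, hle⟩ := exists_weight_le (by linarith) hcont h₀eq
  have hI : ∫⁻ x, ENNReal.ofReal (h₀ x * (1 + ‖x‖ ^ 2)) ≠ ⊤ := by
    have hint : Integrable (fun x : Plane => D * (1 + ‖x‖) ^ (-(κ - 2))) volume :=
      (integrable_one_add_norm (by rw [finrank_euclideanSpace]; simp; linarith)).const_mul D
    refine ne_top_of_le_ne_top hint.lintegral_lt_top.ne ?_
    exact lintegral_mono fun x => ENNReal.ofReal_le_ofReal (hle x)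
  have hB (x : Plane) : ENNReal.ofReal (h₀ x * (1 + ‖x‖ ^ 2)) ≤ ENNReal.ofReal D := by
    refine ENNReal.ofReal_le_ofReal ((hle x).trans ?_)
    refine mul_le_of_le_one_right hD.le ?_
    exact rpow_le_one_of_one_le_of_nonpos (by linarith [norm_nonneg x]) (by linarith)
  have huniv : wMeasure h₀ Set.univ = ∫⁻ x, ENNReal.ofReal (h₀ x) := by
    rw [wMeasure, withDensity_apply _ MeasurableSet.univ, Measure.restrict_univ]
  have hfin : IsFiniteMeasure (wMeasure h₀) := by
    refine ⟨?_⟩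
    rw [huniv]
    refine (ne_top_of_le_ne_top hI (lintegral_mono fun x => ENNReal.ofReal_le_ofReal ?_)).lt_top
    nlinarith [h0 x, mul_nonneg (h0 x) (sq_nonneg ‖x‖)]
  have hpos : wMeasure h₀ Set.univ ≠ 0 := by
    rw [huniv, Ne, lintegral_eq_zero_iff (by fun_prop)]
    intro hz
    obtain ⟨x, hx⟩ := hz.exists
    exact (ENNReal.ofReal_pos.2 (h₀pos x)).ne' hx
  set K : ℝ≥0∞ :=
    2 * (4 * ENNReal.ofReal D * ∫⁻ x, ENNReal.ofReal (h₀ x * (1 + ‖x‖ ^ 2))) with hK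
  have hKtop : K ≠ ⊤ := by finiteness
  set M := (wMeasure h₀ Set.univ).toReal
  have hM : 0 < M := ENNReal.toReal_pos hpos (measure_ne_top _ _)
  refine ⟨K.toReal / M + 1, by positivity, fun u hu => ?_⟩
  obtain ⟨⟨hdiff, hgrad, hsq⟩, hmean⟩ := hu
  have hint : Integrable u (wMeasure h₀) :=
    ((memLp_two_iff_integrable_sq hdiff.continuous.aestronglyMeasurable).2 hsq).integrable
      (by norm_num)
  have hmain := (measure_mul_lintegral_sq_le hint hsq hmean).trans
    (lintegral_sub_sq_le hdiff hcont h0 hB)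
  rw [← hK, ← ofReal_integral_eq_lintegral_ofReal hsq (Eventually.of_forall fun x => sq_nonneg _),
    ← ofReal_integral_eq_lintegral_ofReal hgrad (Eventually.of_forall fun x => sq_nonneg _)]
    at hmain
  have hreal := ENNReal.toReal_mono (by finiteness) hmain
  have hS : 0 ≤ ∫ x, u x ^ 2 ∂(wMeasure h₀) := integral_nonneg fun x => sq_nonneg _
  have hE : 0 ≤ ∫ x, ‖gradient u x‖ ^ 2 := integral_nonneg fun x => sq_nonneg _
  rw [ENNReal.toReal_mul, ENNReal.toReal_mul, ENNReal.toReal_ofReal hS,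
    ENNReal.toReal_ofReal hE] at hreal
  have hdiv : ∫ x, u x ^ 2 ∂(wMeasure h₀) ≤ K.toReal / M * ∫ x, ‖gradient u x‖ ^ 2 := by
    rw [div_mul_eq_mul_div, le_div_iff₀ hM]
    linarith
  linarith
end
end
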